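/- (Lemma B.2) All periodic Temperley–Lieb intertwiners between sectors whose S^z-values differ by an odd integer come from U_q^odd sl(2): for integers k, t with 0 ≤ k ≤ N and 0 ≤ k−2t−1 ≤ N, every linear map T : H_(k) → H_(k−2t−1) satisfying T e_j = e_j T on H_(k) for all 1 ≤ j ≤ N (periodic convention) is a scalar multiple of the restriction to H_(k) of F†_(2t+1) if t ≥ 0, and a scalar multiple of the restriction to H_(k) of F_(−2t−1) if t ≤ −1. -/

import Mathlib

open Complex Matrix

noncomputable section

namespace SpinChain

/-- The state space of the `N`-site spin chain, `(ℂ²)^{⊗N}` realised as functions on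
spin configurations. -/
abbrev V (N : ℕ) := (Fin N → Fin 2) → ℂ

/-- Operators on the spin chain, realised as matrices. -/
abbrev Op (N : ℕ) := Matrix (Fin N → Fin 2) (Fin N → Fin 2) ℂ

def sigmaX : Matrix (Fin 2) (Fin 2) ℂ := !![0, 1; 1, 0]
def sigmaY : Matrix (Fin 2) (Fin 2) ℂ := !![0, -I; I, 0]
def sigmaZ : Matrix (Fin 2) (Fin 2) ℂ := !![1, 0; 0, -1]
def sigmaPlus : Matrix (Fin 2) (Fin 2) ℂ := ((1 : ℂ)/2) • (sigmaX + I • sigmaY)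
def sigmaMinus : Matrix (Fin 2) (Fin 2) ℂ := ((1 : ℂ)/2) • (sigmaX - I • sigmaY)

variable (N : ℕ)

/-- The operator acting as the 2×2 matrix `a` on the `j`-th tensor factor and as the
identity on the others. -/
def site (a : Matrix (Fin 2) (Fin 2) ℂ) (j : Fin N) : Op N :=
  Matrix.of fun x y =>
    a (x j) (y j) * ∏ k ∈ Finset.univ.filter (fun k => k ≠ j), (if x k = y k then (1 : ℂ) else 0)

/-- Jordan–Wigner string `∏_{k<j} diag(z 0, z 1)_k`. -/
def string (z : Fin 2 → ℂ) (j : Fin N) : Op N :=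
  (((List.finRange N).filter (fun k => decide (k < j))).map
    (fun k => site N (Matrix.diagonal z) k)).prod

/-- Jordan–Wigner fermion `c_j := i^{1−j}·(∏_{k<j} diag(−i,i)_k)·σ⁻_j`; here the index
`j : Fin N` labels the physical site `j+1`. -/
def c (j : Fin N) : Op N :=
  (I ^ (-(j : ℤ))) • (string N ![-I, I] j * site N sigmaMinus j)

/-- Jordan–Wigner fermion `c_j† := i^{j−1}·(∏_{k<j} diag(i,−i)_k)·σ⁺_j`. -/
def cd (j : Fin N) : Op N :=
  (I ^ ((j : ℕ))) • (string N ![I, -I] j * site N sigmaPlus j)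

/-- The `gl(1|1)` fermion `f_j := i^j c_j` (physical index `j = j.val + 1`). -/
def f (j : Fin N) : Op N := (I ^ ((j : ℕ) + 1)) • c N j

/-- The `gl(1|1)` fermion `f_j† := i^j c_j†`. -/
def fd (j : Fin N) : Op N := (I ^ ((j : ℕ) + 1)) • cd N j

/-- Cyclic successor on site indices. -/
def fsucc {N : ℕ} (j : Fin N) : Fin N := ⟨(j.val + 1) % N, Nat.mod_lt _ j.pos⟩

/-- Periodic Temperley–Lieb generators
`e_j = (f_j+f_{j+1})(f_j†+f_{j+1}†)`, with `e_N = (f_N+f_1)(f_N†+f_1†)`. -/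
def e (j : Fin N) : Op N := (f N j + f N (fsucc j)) * (fd N j + fd N (fsucc j))

/-- `F_(m) := Σ_{j_1<⋯<j_m} f_{j_1}⋯f_{j_m}`. -/
def Fg (m : ℕ) : Op N :=
  ∑ s ∈ Finset.univ.powersetCard m, ((s.sort (· ≤ ·)).map (f N)).prod

/-- `F†_(m) := Σ_{j_1<⋯<j_m} f†_{j_1}⋯f†_{j_m}`. -/
def Fdg (m : ℕ) : Op N :=
  ∑ s ∈ Finset.univ.powersetCard m, ((s.sort (· ≤ ·)).map (fd N)).prod

/-- `S^z := (1/2) Σ_j σ^z_j`. -/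
def Sz : Op N := ((1 : ℂ)/2) • ∑ j : Fin N, site N sigmaZ j


/-- The sector `H_(k)`: the eigenspace of `S^z` with eigenvalue `L − k`. -/
def sector (L : ℕ) (k : ℤ) : Submodule ℂ (V (2 * L)) :=
  Module.End.eigenspace (Matrix.mulVecLin (Sz (2 * L))) ((L : ℂ) - (k : ℂ))

/-- The space of periodic Temperley–Lieb intertwiners `H_(k) → H_(k−2t−1)`:
linear maps commuting with all `e_j`, `1 ≤ j ≤ N` (periodic convention),
on `H_(k)`. -/
def EperOddSet (L : ℕ) (k t : ℤ) :
    Set (↥(sector L k) →ₗ[ℂ] ↥(sector L (k - 2 * t - 1))) :=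
  {T | ∀ j : Fin (2 * L),
    ∀ v w : ↥(sector L k), (w : V (2 * L)) = (e (2 * L) j).mulVec (v : V (2 * L)) →
      ((T w : V (2 * L))) = (e (2 * L) j).mulVec ((T v : V (2 * L)))}

section Fermions

variable {N : ℕ}

/-- The amplitude with which `f_j` and `f_j†` flip the spin at site `j` of a configuration. -/
def phase (j : Fin N) (x : Fin N → Fin 2) : ℂ :=
  I ^ ((j : ℕ) + 1) * ∏ k ∈ Finset.univ.filter (· < j), (if x k = 0 then (-1 : ℂ) else 1)

lemma string_eq_diagonal (z : Fin 2 → ℂ) (j : Fin N) :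
    string N z j = Matrix.diagonal fun x => ∏ k ∈ Finset.univ.filter (· < j), z (x k) := by
  have hsite (k : Fin N) : site N (Matrix.diagonal z) k =
      Matrix.diagonalRingHom (Fin N → Fin 2) ℂ fun x => z (x k) := by
    ext x y
    by_cases hxy : x = y
    · subst hxy
      simp [site]
    · simp only [site, Matrix.of_apply, Matrix.diagonalRingHom_apply,
        Matrix.diagonal_apply_ne _ hxy]
      obtain ⟨l, hl⟩ := Function.ne_iff.mp hxy
      by_cases hlk : l = k
      · subst hlk
        simp [Matrix.diagonal_apply_ne _ hl]
      · rw [Finset.prod_eq_zero (i := l) (by simp [hlk]) (by simp [hl]), mul_zero]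
  have hlist (l : List (Fin N)) : (l.map fun k => site N (Matrix.diagonal z) k).prod =
      Matrix.diagonalRingHom (Fin N → Fin 2) ℂ (l.map fun k x => z (x k)).prod := by
    rw [map_list_prod, List.map_map]
    exact congrArg List.prod (List.map_congr_left fun k _ => hsite k)
  rw [string, hlist, Matrix.diagonalRingHom_apply]
  congr 1
  ext x
  rw [← List.prod_toFinset _ ((List.nodup_finRange N).filter _), Finset.prod_apply]
  refine Finset.prod_congr ?_ fun _ _ => rfl
  ext k
  simp

lemma pow_mul_prod_lt (w : ℂ) (z : Fin 2 → ℂ) (hz : ∀ s, w * z s = if s = 0 then (-1 : ℂ) else 1)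
    (j : Fin N) (x : Fin N → Fin 2) :
    w ^ (j : ℕ) * ∏ k ∈ Finset.univ.filter (· < j), z (x k) =
      ∏ k ∈ Finset.univ.filter (· < j), (if x k = 0 then (-1 : ℂ) else 1) := by
  have hcard : (Finset.univ.filter (· < j)).card = (j : ℕ) := by
    have : Finset.univ.filter (· < j) = Finset.Iio j := by ext; simp
    rw [this, Fin.card_Iio]
  rw [← hcard, ← Finset.prod_const, ← Finset.prod_mul_distrib]
  exact Finset.prod_congr rfl fun k _ => hz _

lemma site_apply (a : Matrix (Fin 2) (Fin 2) ℂ) (j : Fin N) (x y : Fin N → Fin 2) :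
    site N a j x y = if y = Function.update x j (y j) then a (x j) (y j) else 0 := by
  rw [site, Matrix.of_apply, Finset.prod_ite_zero]
  have : (∀ k ∈ Finset.univ.filter (fun k => k ≠ j), x k = y k) ↔
      y = Function.update x j (y j) := by
    rw [Function.eq_update_iff]
    simp [eq_comm]
  simp only [this, mul_ite, Finset.prod_const_one, mul_one, mul_zero]

lemma f_apply (j : Fin N) (x y : Fin N → Fin 2) :
    f N j x y = if x j = 1 ∧ y = Function.update x j 0 then phase j x else 0 := by
  have hz : ∀ s : Fin 2, I⁻¹ * ![-I, I] s = if s = 0 then (-1 : ℂ) else 1 := by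
    intro s
    fin_cases s <;> simp
  rw [f, c, Matrix.smul_apply, Matrix.smul_apply, string_eq_diagonal, Matrix.diagonal_mul,
    _root_.zpow_neg, zpow_natCast, ← inv_pow, site_apply, phase, ← pow_mul_prod_lt _ _ hz]
  have hs : sigmaMinus = !![0, 0; 1, 0] := by
    ext a b
    fin_cases a <;> fin_cases b <;> norm_num [sigmaMinus, sigmaX, sigmaY]
  rw [hs]
  generalize hx : x j = a
  generalize hy : y j = b
  have key (h : b = 1) : y ≠ Function.update x j 0 := by
    rintro rfl
    simp_all
  fin_cases a <;> fin_cases b <;> simp_all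

lemma fd_apply (j : Fin N) (x y : Fin N → Fin 2) :
    fd N j x y = if x j = 0 ∧ y = Function.update x j 1 then phase j x else 0 := by
  have hz : ∀ s : Fin 2, I * ![I, -I] s = if s = 0 then (-1 : ℂ) else 1 := by
    intro s
    fin_cases s <;> simp
  rw [fd, cd, Matrix.smul_apply, Matrix.smul_apply, string_eq_diagonal, Matrix.diagonal_mul,
    site_apply, phase, ← pow_mul_prod_lt _ _ hz]
  have hs : sigmaPlus = !![0, 1; 0, 0] := by
    ext a b
    fin_cases a <;> fin_cases b <;> norm_num [sigmaPlus, sigmaX, sigmaY]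
  rw [hs]
  generalize hx : x j = a
  generalize hy : y j = b
  have key (h : b = 0) : y ≠ Function.update x j 1 := by
    rintro rfl
    simp_all
  fin_cases a <;> fin_cases b <;> simp_all

lemma f_mul_apply {ι : Type*} (j : Fin N) (A : Matrix (Fin N → Fin 2) ι ℂ)
    (x : Fin N → Fin 2) (y : ι) :
    (f N j * A) x y = if x j = 1 then phase j x * A (Function.update x j 0) y else 0 := by
  by_cases h : x j = 1 <;> simp [Matrix.mul_apply, f_apply, h]

lemma fd_mul_apply {ι : Type*} (j : Fin N) (A : Matrix (Fin N → Fin 2) ι ℂ)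
    (x : Fin N → Fin 2) (y : ι) :
    (fd N j * A) x y = if x j = 0 then phase j x * A (Function.update x j 1) y else 0 := by
  by_cases h : x j = 0 <;> simp [Matrix.mul_apply, fd_apply, h]

lemma phase_update_of_le {j l : Fin N} (h : j ≤ l) (x : Fin N → Fin 2) (a : Fin 2) :
    phase j (Function.update x l a) = phase j x := by
  unfold phase
  congr 1
  refine Finset.prod_congr rfl fun k hk => ?_
  rw [Function.update_of_ne (by rintro rfl; simp at hk; omega)]

lemma phase_update_of_lt {j l : Fin N} (h : l < j) (x : Fin N → Fin 2) {a : Fin 2}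
    (ha : a ≠ x l) : phase j (Function.update x l a) = - phase j x := by
  unfold phase
  rw [← Finset.mul_prod_erase _ _ (a := l) (by simpa using h),
    ← Finset.mul_prod_erase _ (fun k => if x k = 0 then (-1 : ℂ) else 1) (a := l)
      (by simpa using h)]
  have : ∏ k ∈ (Finset.univ.filter (· < j)).erase l,
      (if Function.update x l a k = 0 then (-1 : ℂ) else 1) =
      ∏ k ∈ (Finset.univ.filter (· < j)).erase l, (if x k = 0 then (-1 : ℂ) else 1) :=
    Finset.prod_congr rfl fun k hk => by
      rw [Function.update_of_ne (Finset.ne_of_mem_erase hk)]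
  rw [this, Function.update_self]
  generalize x l = b at *
  fin_cases a <;> fin_cases b <;> simp at *

lemma phase_mul_self (j : Fin N) (x : Fin N → Fin 2) :
    phase j x * phase j x = (-1) ^ ((j : ℕ) + 1) := by
  unfold phase
  rw [mul_mul_mul_comm, ← mul_pow, I_mul_I, ← Finset.prod_mul_distrib, Finset.prod_eq_one,
    mul_one]
  intro k _
  split_ifs <;> simp

lemma phase_ne_zero (j : Fin N) (x : Fin N → Fin 2) : phase j x ≠ 0 := by
  intro h
  have := phase_mul_self j x
  rw [h, zero_mul] at this
  exact pow_ne_zero _ (by norm_num) this.symm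

lemma f_transpose (j : Fin N) : (f N j)ᵀ = fd N j := by
  ext x y
  rw [Matrix.transpose_apply, f_apply, fd_apply]
  by_cases h : y j = 1 ∧ x = Function.update y j 0
  · obtain ⟨h1, rfl⟩ := h
    have hy : Function.update y j 1 = y := by rw [← h1, Function.update_eq_self]
    simp [h1, phase_update_of_le, hy]
  · rw [if_neg h, if_neg]
    rintro ⟨h0, rfl⟩
    simp [← h0] at h

lemma fd_transpose (j : Fin N) : (fd N j)ᵀ = f N j := by
  rw [← f_transpose, Matrix.transpose_transpose]

lemma f_mul_f_self (j : Fin N) : f N j * f N j = 0 := by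
  ext x y
  simp [f_mul_apply, f_apply]

lemma f_mul_f (i j : Fin N) : f N i * f N j = -(f N j * f N i) := by
  rcases eq_or_ne i j with rfl | hij
  · simp [f_mul_f_self]
  wlog h : i < j generalizing i j
  · rw [this j i hij.symm (by omega), neg_neg]
  rw [← mul_one (f N i), ← mul_one (f N j), mul_assoc, mul_assoc, one_mul, one_mul]
  ext x y
  rw [Matrix.neg_apply, f_mul_apply, f_mul_apply, f_mul_apply, f_mul_apply,
    Function.update_of_ne hij, Function.update_of_ne hij.symm, Function.update_comm hij]
  by_cases hi : x i = 1
  · by_cases hj : x j = 1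
    · rw [phase_update_of_lt h x (by simp [hi]), phase_update_of_le h.le]
      simp [hi, hj]
      ring
    · simp [hi, hj]
  · simp [hi]

lemma fd_mul_f_of_ne {i j : Fin N} (hij : i ≠ j) : fd N i * f N j = -(f N j * fd N i) := by
  rw [← mul_one (f N j), ← mul_one (fd N i), mul_assoc, mul_assoc, one_mul, one_mul]
  ext x y
  rw [Matrix.neg_apply, f_mul_apply, fd_mul_apply, fd_mul_apply, f_mul_apply,
    Function.update_of_ne hij, Function.update_of_ne hij.symm, Function.update_comm hij]
  by_cases hi : x i = 0
  · by_cases hj : x j = 1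
    · rcases lt_or_gt_of_ne hij with h | h
      · rw [phase_update_of_lt h x (by simp [hi]), phase_update_of_le h.le]
        simp [hi, hj]
        ring
      · rw [phase_update_of_lt h x (by simp [hj]), phase_update_of_le h.le]
        simp [hi, hj]
        ring
    · simp [hi, hj]
  · simp [hi]

lemma fd_mul_f_self (j : Fin N) :
    fd N j * f N j = ((-1 : ℂ) ^ ((j : ℕ) + 1)) • (1 : Op N) - f N j * fd N j := by
  rw [← mul_one (f N j), ← mul_one (fd N j), mul_assoc, mul_assoc, one_mul, one_mul]
  ext x y
  rw [Matrix.sub_apply, Matrix.smul_apply, ← phase_mul_self j x, f_mul_apply, fd_mul_apply,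
    fd_mul_apply, f_mul_apply, Function.update_idem, Function.update_idem]
  by_cases hj : x j = 0
  · have hx : Function.update x j 0 = x := by rw [← hj, Function.update_eq_self]
    rw [hx]
    simp [hj, phase_update_of_le, mul_assoc]
  · have hj1 : x j = 1 := by omega
    have hx : Function.update x j 1 = x := by rw [← hj1, Function.update_eq_self]
    rw [hx]
    simp [hj1, phase_update_of_le, mul_assoc]

end Fermions

section PairOperators

lemma joined_mul {R : Type*} [Ring R] [Algebra ℂ R] {s : ℂ} (hs : s * s = 1)
    {u u' A A' B B' X : R}
    (huA : u * A = -(A * u)) (huA' : u * A' = s • 1 - A' * u)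
    (huB : u * B = -(B * u)) (huB' : u * B' = (-s) • 1 - B' * u)
    (hu'A : u' * A = s • 1 - A * u') (hu'A' : u' * A' = -(A' * u'))
    (hu'B : u' * B = (-s) • 1 - B * u') (hu'B' : u' * B' = -(B' * u'))
    (hA'B : A' * B = -(B * A')) (huX : u * X = 0) (hu'X : u' * X = 0) :
    u * u' * (A * A') * (B * B') * X = (A + B) * (A' + B') * X := by
  have push {v w r : R} {t : ℂ} (h : v * w = t • 1 - r) (Y : R) :
      v * (w * Y) = t • Y - r * Y := by
    rw [← mul_assoc, h, sub_mul, smul_mul_assoc, one_mul]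
  have pushN {v w r : R} (h : v * w = -r) (Y : R) : v * (w * Y) = -(r * Y) := by
    rw [← mul_assoc, h, neg_mul]
  simp only [mul_assoc, push hu'A, push hu'B, pushN hu'A', pushN hu'B', hu'X, mul_sub, mul_neg,
    mul_zero, neg_zero, sub_zero, mul_smul_comm, sub_mul, neg_mul, smul_mul_assoc,
    pushN huA, push huA', pushN huB, push huB', huX, smul_sub, smul_smul, neg_neg, pushN hA'B,
    add_mul, mul_add]
  simp only [hs, neg_smul, one_smul, smul_zero]
  abel

lemma mul_mul_mul_cancel_of_anticomm {R : Type*} [Ring R] [Algebra ℂ R] {s : ℂ} (hs : s * s = 1)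
    {u u' v v' : R} (huu : u * u = 0) (huu' : u' * u = -(u * u')) (hu'u' : u' * u' = 0)
    (hvu : v * u = -(u * v)) (hu'v : u' * v = s • 1 - v * u') (hv'u : v' * u = s • 1 - u * v') :
    u * u' * (v * v') * (u * u') = u * u' := by
  have h1 : u * u' * v = s • u - u * v * u' := by
    rw [mul_assoc, hu'v, mul_sub, mul_smul_comm, mul_one, mul_assoc]
  have h2 : v' * (u * u') = s • u' - u * (v' * u') := by
    rw [← mul_assoc, hv'u, sub_mul, smul_mul_assoc, one_mul, mul_assoc]
  have h3 : u * v * u' * (u * (v' * u')) = 0 := by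
    calc u * v * u' * (u * (v' * u')) = u * v * (u' * u) * (v' * u') := by noncomm_ring
      _ = -(u * (v * u) * (u' * v') * u') := by rw [huu']; noncomm_ring
      _ = u * u * (v * u' * v' * u') := by rw [hvu]; noncomm_ring
      _ = 0 := by rw [huu, zero_mul]
  calc u * u' * (v * v') * (u * u') = u * u' * v * (v' * (u * u')) := by noncomm_ring
    _ = (s * s) • (u * u') - s • (u * u * (v' * u')) - s • (u * v * (u' * u'))
        + u * v * u' * (u * (v' * u')) := by
      rw [h1, h2]
      simp only [sub_mul, mul_sub, smul_mul_assoc, mul_smul_comm, mul_assoc]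
      module
    _ = u * u' := by rw [h3, hs, huu, hu'u']; simp

variable {N : ℕ}

/-- The Temperley–Lieb generator attached to an arbitrary pair of sites. -/
def pairOp (p q : Fin N) : Op N := (f N p + f N q) * (fd N p + fd N q)

lemma e_eq_pairOp (j : Fin N) : e N j = pairOp j (fsucc j) := rfl

lemma pairOp_comm (p q : Fin N) : pairOp p q = pairOp q p := by
  rw [pairOp, pairOp, add_comm (f N p), add_comm (fd N p)]

lemma pairOp_transpose (p q : Fin N) : (pairOp p q)ᵀ = pairOp p q := by
  simp [pairOp, f_transpose, fd_transpose]

/-- The anticommutator of `f_j` and `f_j†`. -/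
def sgn (j : Fin N) : ℂ := (-1) ^ ((j : ℕ) + 1)

lemma sgn_mul_self (j : Fin N) : sgn j * sgn j = 1 := by
  rw [sgn, ← mul_pow]
  simp

lemma sgn_eq_neg {p q : Fin N} (h : Odd ((p : ℕ) + q)) : sgn q = -sgn p := by
  rcases Nat.even_or_odd (p : ℕ) with hp | hp
  · have hq : Odd (q : ℕ) := by grind
    simp [sgn, pow_succ, hp.neg_one_pow, hq.neg_one_pow]
  · have hq : Even (q : ℕ) := by grind
    simp [sgn, pow_succ, hp.neg_one_pow, hq.neg_one_pow]

lemma fd_mul_f (i j : Fin N) :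
    fd N i * f N j = (if i = j then sgn j else 0) • (1 : Op N) - f N j * fd N i := by
  split_ifs with h
  · subst h
    exact fd_mul_f_self i
  · rw [fd_mul_f_of_ne h, zero_smul, zero_sub]

lemma f_mul_fd (i j : Fin N) :
    f N i * fd N j = (if i = j then sgn j else 0) • (1 : Op N) - fd N j * f N i := by
  rw [fd_mul_f]
  rcases eq_or_ne i j with rfl | h
  · simp
  · simp [h, h.symm]

lemma pairOp_commute_f {p q r : Fin N} (hp : p ≠ r) (hq : q ≠ r) :
    Commute (pairOp p q) (f N r) := by
  rw [pairOp, Commute, SemiconjBy, mul_assoc, add_mul (fd N p), fd_mul_f_of_ne hp,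
    fd_mul_f_of_ne hq, ← neg_add, ← mul_add, mul_neg, ← mul_assoc, ← mul_assoc, add_mul (f N p),
    f_mul_f p, f_mul_f q, ← neg_add, ← mul_add, neg_mul, neg_neg]

lemma pairOp_mul_f_left {p q : Fin N} (hpq : p ≠ q) :
    pairOp p q * f N p = f N p * pairOp p q + sgn p • (f N p + f N q) := by
  have h1 : (fd N p + fd N q) * f N p = sgn p • 1 - f N p * (fd N p + fd N q) := by
    rw [add_mul, fd_mul_f, fd_mul_f, if_pos rfl, if_neg hpq.symm, mul_add]
    module
  have h2 : (f N p + f N q) * f N p = -(f N p * (f N p + f N q)) := by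
    rw [add_mul, mul_add, f_mul_f q, f_mul_f_self]
    simp
  rw [pairOp, mul_assoc, h1, mul_sub, ← mul_assoc, h2, mul_smul_comm, mul_one, neg_mul,
    sub_neg_eq_add, mul_assoc, add_comm]

lemma pairOp_mul_f_right {p q : Fin N} (hpq : p ≠ q) :
    pairOp p q * f N q = f N q * pairOp p q + sgn q • (f N p + f N q) := by
  rw [pairOp_comm, pairOp_mul_f_left hpq.symm, add_comm (f N p)]

lemma pairOp_commute_add {p q : Fin N} (hpq : p ≠ q) (h : Odd ((p : ℕ) + q)) :
    Commute (pairOp p q) (f N p + f N q) := by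
  rw [Commute, SemiconjBy, mul_add, pairOp_mul_f_left hpq, pairOp_mul_f_right hpq, sgn_eq_neg h,
    add_mul]
  module

lemma pairOp_commute_mul {p q : Fin N} (hpq : p ≠ q) (h : Odd ((p : ℕ) + q)) :
    Commute (pairOp p q) (f N p * f N q) := by
  rw [Commute, SemiconjBy, ← mul_assoc, pairOp_mul_f_left hpq, add_mul, mul_assoc,
    pairOp_mul_f_right hpq, sgn_eq_neg h, mul_add, smul_mul_assoc, mul_smul_comm, add_mul, mul_add,
    f_mul_f_self, f_mul_f_self, mul_assoc]
  module

lemma f_add_mul_f_add (p q r s : Fin N) :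
    (f N p + f N q) * (f N r + f N s) = -((f N r + f N s) * (f N p + f N q)) := by
  rw [add_mul, mul_add, mul_add, f_mul_f p r, f_mul_f p s, f_mul_f q r, f_mul_f q s, add_mul,
    mul_add, mul_add]
  abel

lemma fd_add_mul_fd_add (p q r s : Fin N) :
    (fd N p + fd N q) * (fd N r + fd N s) = -((fd N r + fd N s) * (fd N p + fd N q)) := by
  simp only [← f_transpose, ← Matrix.transpose_add, ← Matrix.transpose_mul,
    ← Matrix.transpose_neg]
  rw [f_add_mul_f_add]

lemma f_add_mul_self (p q : Fin N) : (f N p + f N q) * (f N p + f N q) = 0 := by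
  rw [add_mul, mul_add, mul_add, f_mul_f q p, f_mul_f_self, f_mul_f_self]
  abel

lemma pairOp_mul_pairOp_mul_pairOp {p q r : Fin N} (hpq : p ≠ q) (hqr : q ≠ r) (hpr : p ≠ r)
    (h : Odd ((p : ℕ) + q)) :
    pairOp p q * pairOp q r * pairOp p q = pairOp p q := by
  refine mul_mul_mul_cancel_of_anticomm (sgn_mul_self q) (f_add_mul_self p q) ?_ ?_ ?_ ?_ ?_
  · simp only [add_mul, mul_add, fd_mul_f, hpq, hpq.symm, sgn_eq_neg h, if_true, if_false]
    module
  · simp only [← f_transpose, ← Matrix.transpose_add, ← Matrix.transpose_mul, f_add_mul_self,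
      Matrix.transpose_zero]
  · exact f_add_mul_f_add _ _ _ _
  · simp only [add_mul, mul_add, fd_mul_f, hpq, hqr, hpr, if_true, if_false]
    module
  · simp only [add_mul, mul_add, fd_mul_f, hpq.symm, hqr.symm, hpr.symm, if_true, if_false]
    module

lemma pairOp_mul_joined {p a b q : Fin N} (hpa : p ≠ a) (hpb : p ≠ b) (hpq : p ≠ q) (hab : a ≠ b)
    (haq : a ≠ q) (hbq : b ≠ q) (h : Odd ((a : ℕ) + b)) {X : Op N}
    (hX : (f N a + f N b) * X = 0) (hX' : (fd N a + fd N b) * X = 0) :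
    pairOp a b * pairOp p a * pairOp b q * X = pairOp p q * X := by
  have hsum : (f N p + f N a + (f N b + f N q)) * (fd N p + fd N a + (fd N b + fd N q)) * X =
      pairOp p q * X := by
    have h1 : (f N a + f N b) * (fd N p + fd N q) = -((fd N p + fd N q) * (f N a + f N b)) := by
      simp only [add_mul, mul_add, fd_mul_f, hpa, hpb, haq.symm, hbq.symm, if_false]
      module
    calc (f N p + f N a + (f N b + f N q)) * (fd N p + fd N a + (fd N b + fd N q)) * X
        = (f N p + f N q) * (fd N p + fd N q) * X
          + (f N a + f N b) * (fd N p + fd N q) * X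
          + (f N p + f N a + (f N b + f N q)) * ((fd N a + fd N b) * X) := by noncomm_ring
      _ = pairOp p q * X := by
        rw [hX', h1, neg_mul, mul_assoc (fd N p + fd N q), hX, pairOp]
        simp
  rw [← hsum]
  refine joined_mul (sgn_mul_self a) ?_ ?_ ?_ ?_ ?_ ?_ ?_ ?_ ?_ hX hX'
  · exact f_add_mul_f_add _ _ _ _
  · simp only [add_mul, mul_add, f_mul_fd, hpa.symm, hpb.symm, hab.symm, if_true, if_false]
    module
  · exact f_add_mul_f_add _ _ _ _
  · simp only [add_mul, mul_add, f_mul_fd, haq, hab, hbq, sgn_eq_neg h, if_true, if_false]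
    module
  · simp only [add_mul, mul_add, fd_mul_f, hpa.symm, hpb.symm, hab.symm, if_true, if_false]
    module
  · exact fd_add_mul_fd_add _ _ _ _
  · simp only [add_mul, mul_add, fd_mul_f, haq, hab, hbq, sgn_eq_neg h, if_true, if_false]
    module
  · exact fd_add_mul_fd_add _ _ _ _
  · simp only [add_mul, mul_add, fd_mul_f, hpb, hpq, hab, haq, if_false]
    module

end PairOperators

section OrderedSums

/-- The sum of the products of the length-`m` sublists of `l`, in the order of `l`. -/
def ordSum {R : Type*} [Semiring R] : List R → ℕ → R
  | _, 0 => 1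
  | [], _ + 1 => 0
  | a :: l, m + 1 => a * ordSum l m + ordSum l (m + 1)

section Ring

variable {R : Type*} [Ring R]

@[simp] lemma ordSum_zero (l : List R) : ordSum l 0 = 1 := by
  cases l <;> rfl

@[simp] lemma ordSum_nil_succ (m : ℕ) : ordSum ([] : List R) (m + 1) = 0 := rfl

lemma ordSum_cons_succ (a : R) (l : List R) (m : ℕ) :
    ordSum (a :: l) (m + 1) = a * ordSum l m + ordSum l (m + 1) := rfl

lemma sum_powersetCard_sort_prod {α : Type*} [LinearOrder α] (g : α → R) (l : List α)
    (hl : l.SortedLT) (m : ℕ) :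
    ∑ s ∈ l.toFinset.powersetCard m, ((s.sort (· ≤ ·)).map g).prod = ordSum (l.map g) m := by
  induction l generalizing m with
  | nil =>
    cases m with
    | zero => simp
    | succ m =>
      rw [Finset.powersetCard_eq_empty.mpr (by simp)]
      simp
  | cons a l ih =>
    cases m with
    | zero => simp
    | succ m =>
      have hl' := List.pairwise_cons.mp hl.pairwise
      have ha : a ∉ l.toFinset := by
        intro h
        exact lt_irrefl a (hl'.1 a (by simpa using h))
      rw [List.toFinset_cons, Finset.powersetCard_succ_insert ha, Finset.sum_union,
        Finset.sum_image, List.map_cons, ordSum_cons_succ, ih hl'.2.sortedLT, add_comm,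
        ← ih hl'.2.sortedLT m, Finset.mul_sum]
      · congr 1
        refine Finset.sum_congr rfl fun s hs => ?_
        have hs' := (Finset.mem_powersetCard.mp hs).1
        rw [Finset.sort_insert (r := (· ≤ ·)) (fun b hb => (hl'.1 b (by simpa using hs' hb)).le)
          (fun h => ha (hs' h)), List.map_cons, List.prod_cons]
      · intro s hs t ht hst
        have hs' := (Finset.mem_powersetCard.mp hs).1
        have ht' := (Finset.mem_powersetCard.mp ht).1
        rw [← Finset.erase_insert (fun h => ha (hs' h)), hst,
          Finset.erase_insert (fun h => ha (ht' h))]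
      · rw [Finset.disjoint_left]
        intro s hs hs2
        obtain ⟨t, _, rfl⟩ := Finset.mem_image.mp hs2
        exact ha ((Finset.mem_powersetCard.mp hs).1 (Finset.mem_insert_self _ _))

lemma commute_ordSum {b : R} {l : List R} (h : ∀ x ∈ l, Commute b x) (m : ℕ) :
    Commute b (ordSum l m) := by
  induction l generalizing m with
  | nil => cases m <;> simp
  | cons a l ih =>
    cases m with
    | zero => simp
    | succ m =>
      have ih' := ih fun x hx => h x (List.mem_cons_of_mem _ hx)
      exact ((h a List.mem_cons_self).mul_right (ih' m)).add_right (ih' _)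

lemma commute_ordSum_pair {b a a' : R} {l₁ l₂ : List R} (h₁ : ∀ x ∈ l₁, Commute b x)
    (h₂ : ∀ x ∈ l₂, Commute b x) (hadd : Commute b (a + a')) (hmul : Commute b (a * a')) (m : ℕ) :
    Commute b (ordSum (l₁ ++ a :: a' :: l₂) m) := by
  induction l₁ generalizing m with
  | nil =>
    match m with
    | 0 => simp
    | 1 =>
      simp only [List.nil_append, ordSum_cons_succ, ordSum_zero, mul_one, ← add_assoc]
      exact hadd.add_right (commute_ordSum h₂ _)
    | m + 2 =>
      simp only [List.nil_append, ordSum_cons_succ, mul_add, ← mul_assoc]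
      have : a * a' * ordSum l₂ m + a * ordSum l₂ (m + 1) +
          (a' * ordSum l₂ (m + 1) + ordSum l₂ (m + 1 + 1)) =
          a * a' * ordSum l₂ m + (a + a') * ordSum l₂ (m + 1) + ordSum l₂ (m + 1 + 1) := by
        noncomm_ring
      rw [this]
      exact ((hmul.mul_right (commute_ordSum h₂ _)).add_right
        (hadd.mul_right (commute_ordSum h₂ _))).add_right (commute_ordSum h₂ _)
  | cons c l ih =>
    cases m with
    | zero => simp
    | succ m =>
      have ih' := ih fun x hx => h₁ x (List.mem_cons_of_mem _ hx)
      exact ((h₁ c List.mem_cons_self).mul_right (ih' m)).add_right (ih' _)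

lemma ordSum_concat_succ (l : List R) (a : R) (m : ℕ) :
    ordSum (l ++ [a]) (m + 1) = ordSum l (m + 1) + ordSum l m * a := by
  induction l generalizing m with
  | nil => cases m <;> simp [ordSum_cons_succ]
  | cons b l ih =>
    cases m with
    | zero =>
      simp only [List.cons_append, ordSum_cons_succ, ih, ordSum_zero]
      noncomm_ring
    | succ m =>
      simp only [List.cons_append, ordSum_cons_succ, ih]
      noncomm_ring

lemma mul_ordSum_of_anticomm {a : R} {l : List R} (h : ∀ x ∈ l, a * x = -(x * a)) (m : ℕ) :
    a * ordSum l m = (-1) ^ m * (ordSum l m * a) := by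
  induction l generalizing m with
  | nil => cases m <;> simp
  | cons b l ih =>
    cases m with
    | zero => simp
    | succ m =>
      have ih' := ih fun x hx => h x (List.mem_cons_of_mem _ hx)
      have hb : b * (-1) ^ m = (-1) ^ m * b := ((Commute.neg_one_right b).pow_right m).eq
      rw [ordSum_cons_succ, mul_add, ih', ← mul_assoc, h b List.mem_cons_self, neg_mul, mul_assoc,
        ih' m, ← mul_assoc b, hb, pow_succ]
      noncomm_ring

end Ring

variable {N : ℕ}

/-- The ordered elementary symmetric expression in the fermions `f_j`, `j` running through `l`. -/
def ordF (l : List (Fin N)) (m : ℕ) : Op N := ordSum (l.map (f N)) m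

lemma Fg_eq_ordF (m : ℕ) : Fg N m = ordF (List.finRange N) m := by
  rw [Fg, ordF, ← sum_powersetCard_sort_prod _ _ (List.sortedLT_finRange N), List.toFinset_finRange]

lemma ordSum_fd_transpose (m : ℕ) : ∃ s : ℂ, s ≠ 0 ∧ ∀ l : List (Fin N),
    ordSum (l.map (fd N)) m = s • (ordF l m)ᵀ := by
  induction m with
  | zero => exact ⟨1, one_ne_zero, fun l => by simp [ordF]⟩
  | succ m ih =>
    obtain ⟨s, hs0, hs⟩ := ih
    refine ⟨(-1) ^ m * s, mul_ne_zero (pow_ne_zero _ (by norm_num)) hs0, fun l => ?_⟩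
    induction l with
    | nil => simp [ordF]
    | cons a l ihl =>
      have key := mul_ordSum_of_anticomm (a := f N a) (l := l.map (f N))
        (by simpa using fun b _ => f_mul_f a b) m
      rw [ordF, List.map_cons, List.map_cons, ordSum_cons_succ, ordSum_cons_succ, key, ihl, hs]
      rcases neg_one_pow_eq_or ℂ m with h | h
      · have h' : (-1 : Op N) ^ m = 1 := by
          rcases Nat.even_or_odd m with hm | hm
          · exact hm.neg_one_pow
          · rw [hm.neg_one_pow] at h; norm_num at h
        simp [h, h', ordF, f_transpose]
      · have h' : (-1 : Op N) ^ m = -1 := by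
          rcases Nat.even_or_odd m with hm | hm
          · rw [hm.neg_one_pow] at h; norm_num at h
          · exact hm.neg_one_pow
        simp [h, h', ordF, f_transpose]

lemma Fdg_eq_transpose (N m : ℕ) : ∃ s : ℂ, s ≠ 0 ∧ Fdg N m = s • (Fg N m)ᵀ := by
  obtain ⟨s, hs0, hs⟩ := ordSum_fd_transpose (N := N) m
  refine ⟨s, hs0, ?_⟩
  rw [Fg_eq_ordF, ← hs, Fdg, ← sum_powersetCard_sort_prod _ _ (List.sortedLT_finRange N),
    List.toFinset_finRange]

lemma pairOp_commute_ordF {p q : Fin N} {l₁ l₂ : List (Fin N)} (hl : (l₁ ++ p :: q :: l₂).Nodup)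
    (h : Odd ((p : ℕ) + q)) (m : ℕ) : Commute (pairOp p q) (ordF (l₁ ++ p :: q :: l₂) m) := by
  have hpq : p ≠ q := by rintro rfl; simp [List.nodup_append] at hl
  rw [ordF, List.map_append, List.map_cons, List.map_cons]
  refine commute_ordSum_pair ?_ ?_ (pairOp_commute_add hpq h) (pairOp_commute_mul hpq h) m
  · intro x hx
    obtain ⟨r, hr, rfl⟩ := List.mem_map.mp hx
    exact pairOp_commute_f (by rintro rfl; simp [List.nodup_append] at hl; grind)
      (by rintro rfl; simp [List.nodup_append] at hl; grind)
  · intro x hx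
    obtain ⟨r, hr, rfl⟩ := List.mem_map.mp hx
    exact pairOp_commute_f (by rintro rfl; simp [List.nodup_append] at hl; grind)
      (by rintro rfl; simp [List.nodup_append] at hl; grind)

lemma pairOp_commute_Fg {p q : Fin N} (hpq : (p : ℕ) + 1 = q) (m : ℕ) :
    Commute (pairOp p q) (Fg N m) := by
  have hsplit : List.finRange N = (List.finRange N).take p ++
      p :: q :: (List.finRange N).drop ((q : ℕ) + 1) := by
    conv_lhs => rw [← List.take_append_drop (p : ℕ) (List.finRange N)]
    rw [List.drop_eq_getElem_cons (by simp), List.drop_eq_getElem_cons (by simp; omega)]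
    simp [hpq]
  rw [Fg_eq_ordF, hsplit]
  refine pairOp_commute_ordF ?_ ?_ m
  · rw [← hsplit]
    exact List.nodup_finRange N
  · exact ⟨p, by omega⟩

lemma finRange_eq_cons_concat (n : ℕ) : ∃ l : List (Fin (n + 2)),
    List.finRange (n + 2) = 0 :: (l ++ [Fin.last (n + 1)]) := by
  refine ⟨((List.finRange n).map Fin.castSucc).map Fin.succ, ?_⟩
  rw [List.finRange_succ, List.finRange_succ_last, List.map_append]
  simp

lemma ordF_concat_succ (l : List (Fin N)) (a : Fin N) (m : ℕ) :
    ordF (l ++ [a]) (m + 1) = ordF l (m + 1) + ordF l m * f N a := by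
  rw [ordF, List.map_append]
  exact ordSum_concat_succ _ _ _

lemma ordF_cons_succ (l : List (Fin N)) (a : Fin N) (m : ℕ) :
    ordF (a :: l) (m + 1) = f N a * ordF l m + ordF l (m + 1) := rfl

@[simp] lemma ordF_zero (l : List (Fin N)) : ordF l 0 = 1 := ordSum_zero _

lemma f_mul_ordF (a : Fin N) (l : List (Fin N)) (m : ℕ) :
    f N a * ordF l m = (-1) ^ m * (ordF l m * f N a) :=
  mul_ordSum_of_anticomm (by simpa using fun b _ => f_mul_f a b) m

lemma ordF_rotate_of_odd (a : Fin N) (l : List (Fin N)) {m : ℕ} (hm : Odd m) :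
    ordF (a :: l) m = ordF (l ++ [a]) m := by
  obtain ⟨r, rfl⟩ := hm
  rw [ordF_cons_succ, ordF_concat_succ, f_mul_ordF]
  simp [add_comm]

lemma fsucc_cases (j : Fin (N + 2)) :
    (j : ℕ) + 1 = fsucc j ∨ (j = Fin.last (N + 1) ∧ fsucc j = 0) := by
  by_cases h : (j : ℕ) + 1 < N + 2
  · left
    simp [fsucc, Nat.mod_eq_of_lt h]
  · right
    have hj : j = Fin.last (N + 1) := by
      ext
      simp
      omega
    subst hj
    simp [fsucc]

lemma last_add_zero_odd (hN : Even N) : Odd ((Fin.last (N + 1) : ℕ) + (0 : Fin (N + 2))) := by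
  simpa using hN.add_one

lemma e_commute_Fg (hN : Even N) (j : Fin N) {m : ℕ} (hm : Odd m) :
    Commute (e N j) (Fg N m) := by
  obtain _ | _ | N := N
  · exact j.elim0
  · simp at hN
  have hN' : Even N := by grind
  rw [e_eq_pairOp]
  rcases fsucc_cases j with h | ⟨rfl, h⟩
  · exact pairOp_commute_Fg h m
  · obtain ⟨l, hl⟩ := finRange_eq_cons_concat N
    have hnd := List.nodup_finRange (N + 2)
    rw [hl] at hnd
    rw [h, Fg_eq_ordF, hl, ordF_rotate_of_odd _ _ hm, List.append_assoc]
    refine pairOp_commute_ordF (l₂ := []) ?_ (last_add_zero_odd hN') m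
    simp [List.nodup_append] at hnd ⊢
    grind

end OrderedSums

section Kernel

variable {N : ℕ}

/-- The number of down spins of a configuration. -/
def cnt (x : Fin N → Fin 2) : ℕ := ∑ j, (x j : ℕ)

lemma cnt_update (x : Fin N → Fin 2) (j : Fin N) (a : Fin 2) :
    cnt (Function.update x j a) + (x j : ℕ) = cnt x + (a : ℕ) := by
  unfold cnt
  rw [← Finset.add_sum_erase _ _ (Finset.mem_univ j),
    ← Finset.add_sum_erase _ (fun i => (x i : ℕ)) (Finset.mem_univ j),
    Finset.sum_congr rfl fun i hi => by rw [Function.update_of_ne (Finset.ne_of_mem_erase hi)],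
    Function.update_self]
  ring

lemma cnt_update_one {x : Fin N → Fin 2} {j : Fin N} (h : x j = 0) :
    cnt (Function.update x j 1) = cnt x + 1 := by
  simpa [h] using cnt_update x j 1

lemma cnt_update_zero {x : Fin N → Fin 2} {j : Fin N} (h : x j = 1) :
    cnt (Function.update x j 0) + 1 = cnt x := by
  simpa [h] using cnt_update x j 0

lemma cnt_eq_card (x : Fin N → Fin 2) : cnt x = (Finset.univ.filter fun j => x j = 1).card := by
  rw [cnt, Finset.card_filter]
  refine Finset.sum_congr rfl fun j _ => ?_
  generalize x j = a
  fin_cases a <;> simp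

lemma eq_zero_of_cnt_eq_zero {x : Fin N → Fin 2} (h : cnt x = 0) : x = 0 := by
  ext j
  simpa using (Finset.sum_eq_zero_iff.mp h) j (Finset.mem_univ j)

lemma eq_one_of_cnt_eq {x : Fin N → Fin 2} (h : cnt x = N) : x = 1 := by
  have := (Finset.card_eq_iff_eq_univ _).mp ((cnt_eq_card x).symm.trans (h.trans (by simp)))
  ext j
  have hj : j ∈ Finset.univ.filter fun j => x j = 1 := by rw [this]; exact Finset.mem_univ j
  simp [(Finset.mem_filter.mp hj).2]

lemma cnt_le (x : Fin N → Fin 2) : cnt x ≤ N := by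
  rw [cnt_eq_card]
  exact (Finset.card_le_univ _).trans (by simp)

lemma ordF_support {l : List (Fin N)} {m : ℕ} {x y : Fin N → Fin 2} (h : ordF l m x y ≠ 0) :
    (∀ b ∉ l, x b = y b) ∧ cnt x = cnt y + m := by
  induction l generalizing m x with
  | nil =>
    cases m with
    | zero =>
      obtain rfl : x = y := by
        by_contra hxy
        exact h (by simp [hxy])
      simp
    | succ m => exact absurd rfl h
  | cons a l ih =>
    cases m with
    | zero =>
      obtain rfl : x = y := by
        by_contra hxy
        exact h (by simp [hxy])
      simp
    | succ m =>
      by_cases h2 : ordF l (m + 1) x y = 0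
      · rw [ordF_cons_succ, Matrix.add_apply, h2, add_zero, f_mul_apply] at h
        by_cases hx : x a = 1
        · rw [if_pos hx] at h
          obtain ⟨h3, h4⟩ := ih (right_ne_zero_of_mul h)
          refine ⟨fun b hb => ?_, ?_⟩
          · rw [List.mem_cons, not_or] at hb
            rw [← h3 b hb.2, Function.update_of_ne hb.1]
          · have := cnt_update_zero hx
            omega
        · simp [hx] at h
      · obtain ⟨h3, h4⟩ := ih h2
        exact ⟨fun b hb => h3 b fun hb' => hb (List.mem_cons_of_mem _ hb'), h4⟩

lemma ordF_ne_zero {l : List (Fin N)} (hl : l.Nodup) {m : ℕ} {x y : Fin N → Fin 2} (hyx : y ≤ x)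
    (hb : ∀ b ∉ l, x b = y b) (hc : cnt x = cnt y + m) : ordF l m x y ≠ 0 := by
  induction l generalizing m x with
  | nil =>
    obtain rfl : x = y := funext fun b => hb b (by simp)
    obtain rfl : m = 0 := by omega
    simp
  | cons a l ih =>
    have ha : a ∉ l := (List.nodup_cons.mp hl).1
    by_cases hxa : x a = y a
    · have h2 : ordF l m x y ≠ 0 := ih (List.nodup_cons.mp hl).2 hyx
        (fun b hbl => by
          by_cases hba : b = a
          · rw [hba, hxa]
          · exact hb b (by simp [hba, hbl])) hc
      cases m with
      | zero => simpa using h2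
      | succ m =>
        rw [ordF_cons_succ, Matrix.add_apply, f_mul_apply]
        by_cases hx1 : x a = 1
        · have h3 : ordF l m (Function.update x a 0) y = 0 := by
            by_contra h3
            have := (ordF_support h3).1 a ha
            rw [← hxa, hx1] at this
            simp at this
          simpa [h3] using h2
        · simpa [hx1] using h2
    · have hx1 : x a = 1 ∧ y a = 0 := by
        have : y a ≤ x a := hyx a
        omega
      have hcu := cnt_update_zero hx1.1
      cases m with
      | zero =>
        exfalso
        have hle : cnt y ≤ cnt (Function.update x a 0) := Finset.sum_le_sum fun b _ => by
          by_cases hba : b = a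
          · subst hba
            simp [hx1.2]
          · rw [Function.update_of_ne hba]
            exact hyx b
        omega
      | succ m =>
        have h2 : ordF l (m + 1) x y = 0 := by
          by_contra h2
          exact hxa ((ordF_support h2).1 a ha)
        rw [ordF_cons_succ, Matrix.add_apply, h2, add_zero, f_mul_apply, if_pos hx1.1]
        refine mul_ne_zero (phase_ne_zero _ _) (ih (List.nodup_cons.mp hl).2 ?_ ?_ (by omega))
        · intro b
          by_cases hba : b = a
          · subst hba
            simp [hx1.2]
          · rw [Function.update_of_ne hba]
            exact hyx b
        · intro b hbl
          by_cases hba : b = a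
          · subst hba
            simp [hx1.2]
          · rw [Function.update_of_ne hba]
            exact hb b (by simp [hba, hbl])

lemma Fg_support {m : ℕ} {x y : Fin N → Fin 2} (h : Fg N m x y ≠ 0) : cnt x = cnt y + m := by
  rw [Fg_eq_ordF] at h
  exact (ordF_support h).2

lemma Fg_ne_zero {m : ℕ} {x y : Fin N → Fin 2} (hyx : y ≤ x) (hc : cnt x = cnt y + m) :
    Fg N m x y ≠ 0 := by
  rw [Fg_eq_ordF]
  exact ordF_ne_zero (List.nodup_finRange N) hyx (fun b hb => absurd (List.mem_finRange b) hb) hc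

lemma pairOp_apply_vac (p q : Fin N) (x : Fin N → Fin 2) : pairOp p q x 0 = 0 := by
  have h (j : Fin N) (z : Fin N → Fin 2) : fd N j z 0 = 0 := by
    rw [fd_apply, if_neg]
    rintro ⟨_, hz⟩
    simpa using congrFun hz j
  rw [pairOp, Matrix.mul_apply]
  exact Finset.sum_eq_zero fun z _ => by simp [h]

lemma pairOp_apply_full {p q : Fin N} (hpq : p ≠ q) (hodd : Odd ((p : ℕ) + q))
    (x : Fin N → Fin 2) : pairOp p q x 1 = 0 := by
  have h (j : Fin N) (z : Fin N → Fin 2) : f N j z 1 = 0 := by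
    rw [f_apply, if_neg]
    rintro ⟨_, hz⟩
    simpa using congrFun hz j
  have hanti : pairOp p q = -((fd N p + fd N q) * (f N p + f N q)) := by
    simp only [pairOp, add_mul, mul_add, fd_mul_f, hpq, hpq.symm, sgn_eq_neg hodd, if_true,
      if_false]
    module
  rw [hanti, Matrix.neg_apply, Matrix.mul_apply, Finset.sum_eq_zero fun z _ => by simp [h],
    neg_zero]

lemma pairOp_kernel {ι : Type*} {p q : Fin N} (hpq : p ≠ q) {A : Matrix (Fin N → Fin 2) ι ℂ} {y : ι}
    (hA : ∀ x, (pairOp p q * A) x y = 0) {z : Fin N → Fin 2} (hp : z p = 0) (hq : z q = 0) :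
    phase p z * A (Function.update z p 1) y + phase q z * A (Function.update z q 1) y = 0 := by
  have h := hA (Function.update z p 1)
  rw [pairOp, Matrix.mul_assoc, Matrix.add_mul, Matrix.add_apply, f_mul_apply, f_mul_apply,
    Function.update_self, if_pos rfl, Function.update_of_ne hpq.symm, hq, if_neg (by simp),
    add_zero, Function.update_idem] at h
  have hz : Function.update z p 0 = z := by rw [← hp, Function.update_eq_self]
  rw [hz] at h
  have h' := (mul_eq_zero.mp h).resolve_left (phase_ne_zero _ _)
  rwa [Matrix.add_mul, Matrix.add_apply, fd_mul_apply, fd_mul_apply, if_pos hp, if_pos hq] at h'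

lemma pairOp_kernel_cross {ι κ : Type*} {p q : Fin N} (hpq : p ≠ q)
    {A : Matrix (Fin N → Fin 2) ι ℂ} {B : Matrix (Fin N → Fin 2) κ ℂ} {y : ι} {y' : κ}
    (hA : ∀ x, (pairOp p q * A) x y = 0) (hB : ∀ x, (pairOp p q * B) x y' = 0)
    {z : Fin N → Fin 2} (hp : z p = 0) (hq : z q = 0) :
    A (Function.update z p 1) y * B (Function.update z q 1) y' =
      A (Function.update z q 1) y * B (Function.update z p 1) y' := by
  have h1 := pairOp_kernel hpq hA hp hq
  have h2 := pairOp_kernel hpq hB hp hq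
  refine mul_left_cancel₀ (phase_ne_zero p z) ?_
  linear_combination B (Function.update z q 1) y' * h1 - A (Function.update z q 1) y * h2

lemma exists_perm_of_cnt_eq {x x' : Fin N → Fin 2} (h : cnt x = cnt x') :
    ∃ σ : Equiv.Perm (Fin N), x' = x ∘ σ := by
  have hcard : Fintype.card {j // x' j = 1} = Fintype.card {j // x j = 1} := by
    rw [Fintype.card_subtype, Fintype.card_subtype, ← cnt_eq_card, ← cnt_eq_card, h]
  let E := Fintype.equivOfCardEq hcard
  refine ⟨E.extendSubtype, funext fun j => ?_⟩
  by_cases hj : x' j = 1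
  · rw [Function.comp_apply, E.extendSubtype_mem j hj, hj]
  · have := E.extendSubtype_not_mem j hj
    rw [Function.comp_apply]
    omega

lemma eq_of_adjacent_move_invariant {n k : ℕ} {r : (Fin (n + 1) → Fin 2) → ℂ}
    (h : ∀ (i : Fin n) (z : Fin (n + 1) → Fin 2), z i.castSucc = 0 → z i.succ = 0 →
      cnt z + 1 = k →
        r (Function.update z i.castSucc 1) = r (Function.update z i.succ 1))
    {x x' : Fin (n + 1) → Fin 2} (hx : cnt x = k) (hx' : cnt x' = k) : r x = r x' := by
  have hswap (i : Fin n) (x : Fin (n + 1) → Fin 2) (hx : cnt x = k) :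
      r (x ∘ Equiv.swap i.castSucc i.succ) = r x := by
    set p := i.castSucc
    set q := i.succ
    have hpq : p ≠ q := Fin.castSucc_lt_succ.ne
    set z := Function.update (Function.update x p 0) q 0 with hz
    have hzp : z p = 0 := by simp [hz, Function.update_of_ne hpq]
    have hzq : z q = 0 := by simp [hz]
    have hmove (a b : Fin (n + 1)) (hab : (a = p ∧ b = q) ∨ (a = q ∧ b = p)) (ha : x a = 1)
        (hb : x b = 0) : x = Function.update z a 1 ∧
          x ∘ Equiv.swap p q = Function.update z b 1 := by
      constructor <;> ext j <;> rcases hab with ⟨rfl, rfl⟩ | ⟨rfl, rfl⟩ <;>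
        by_cases hjp : j = p <;> by_cases hjq : j = q <;>
        simp_all [Equiv.swap_apply_of_ne_of_ne]
    by_cases hxp : x p = 1
    · by_cases hxq : x q = 0
      · obtain ⟨h1, h2⟩ := hmove p q (by simp) hxp hxq
        have hcz : cnt z + 1 = k := by rw [← cnt_update_one hzp, ← h1, hx]
        rw [h2, ← h i z hzp hzq hcz, ← h1]
      · have hxq1 : x q = 1 := by omega
        congr 1
        ext j
        by_cases hjp : j = p <;> by_cases hjq : j = q <;>
          simp_all [Equiv.swap_apply_of_ne_of_ne]
    · have hxp0 : x p = 0 := by omega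
      by_cases hxq : x q = 0
      · congr 1
        ext j
        by_cases hjp : j = p <;> by_cases hjq : j = q <;>
          simp_all [Equiv.swap_apply_of_ne_of_ne]
      · have hxq1 : x q = 1 := by omega
        obtain ⟨h1, h2⟩ := hmove q p (by simp) hxq1 hxp0
        have hcz : cnt z + 1 = k := by rw [← cnt_update_one hzq, ← h1, hx]
        rw [h2, h i z hzp hzq hcz, ← h1]
  have hcomp (σ : Equiv.Perm (Fin (n + 1))) (x : Fin (n + 1) → Fin 2) : cnt (x ∘ σ) = cnt x :=
    Equiv.sum_comp σ fun j => (x j : ℕ)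
  have hperm (σ : Equiv.Perm (Fin (n + 1))) :
      ∀ x : Fin (n + 1) → Fin 2, cnt x = k → r (x ∘ σ) = r x := by
    have hσ : σ ∈ Submonoid.closure (Set.range fun i : Fin n ↦ Equiv.swap i.castSucc i.succ) := by
      rw [Equiv.Perm.mclosure_swap_castSucc_succ]
      trivial
    induction hσ using Submonoid.closure_induction with
    | mem τ hτ =>
      obtain ⟨i, rfl⟩ := hτ
      exact hswap i
    | one => simp
    | mul τ ρ _ _ h1 h2 =>
      intro x hx
      rw [Equiv.Perm.coe_mul, ← Function.comp_assoc, h2 _ (by rw [hcomp, hx]), h1 x hx]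
  obtain ⟨σ, rfl⟩ := exists_perm_of_cnt_eq (hx.trans hx'.symm)
  exact (hperm σ x hx).symm

lemma kernel_proportional {ι κ : Type*} {n k : ℕ} {A : Matrix (Fin (n + 1) → Fin 2) ι ℂ}
    {B : Matrix (Fin (n + 1) → Fin 2) κ ℂ} {y : ι} {y' : κ}
    (hA : ∀ (i : Fin n) (x), (pairOp i.castSucc i.succ * A) x y = 0)
    (hB : ∀ (i : Fin n) (x), (pairOp i.castSucc i.succ * B) x y' = 0)
    (hB0 : ∀ x, cnt x = k → B x y' ≠ 0) {x x' : Fin (n + 1) → Fin 2}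
    (hx : cnt x = k) (hx' : cnt x' = k) : A x y * B x' y' = A x' y * B x y' := by
  have h := eq_of_adjacent_move_invariant (k := k) (r := fun x => A x y / B x y')
    (fun i z hp hq hz => by
      rw [div_eq_div_iff (hB0 _ (by rw [cnt_update_one hp, hz]))
        (hB0 _ (by rw [cnt_update_one hq, hz]))]
      exact pairOp_kernel_cross Fin.castSucc_lt_succ.ne (hA i) (hB i) hp hq) hx hx'
  exact (div_eq_div_iff (hB0 _ hx) (hB0 _ hx')).mp h

end Kernel

section Grading

variable {N : ℕ}

lemma exists_scalar_of_kernel {ι κ : Type*} {n k : ℕ} {A : Matrix (Fin (n + 1) → Fin 2) ι ℂ}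
    {B : Matrix (Fin (n + 1) → Fin 2) κ ℂ} {y : ι} {y' : κ}
    (hA : ∀ (i : Fin n) (x), (pairOp i.castSucc i.succ * A) x y = 0)
    (hB : ∀ (i : Fin n) (x), (pairOp i.castSucc i.succ * B) x y' = 0)
    (hA0 : ∀ x, A x y ≠ 0 → cnt x = k) (hB0 : ∀ x, B x y' ≠ 0 ↔ cnt x = k) :
    ∃ c : ℂ, ∀ x, A x y = c * B x y' := by
  by_cases h : ∃ x₀ : Fin (n + 1) → Fin 2, cnt x₀ = k
  · obtain ⟨x₀, hx₀⟩ := h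
    refine ⟨A x₀ y / B x₀ y', fun x => ?_⟩
    have hne := (hB0 x₀).mpr hx₀
    by_cases hx : cnt x = k
    · have := kernel_proportional hA hB (fun x hx => (hB0 x).mpr hx) hx hx₀
      field_simp
      exact this
    · rw [not_not.mp (mt (hA0 x) hx), not_not.mp (mt (hB0 x).mp hx), mul_zero]
  · push Not at h
    exact ⟨0, fun x => by rw [zero_mul]; exact not_not.mp (mt (hA0 x) (h x))⟩

lemma exists_cnt_eq_avoiding {p q : Fin N} (hpq : p ≠ q) {k : ℕ} (hk : k + 2 ≤ N) :
    ∃ z : Fin N → Fin 2, z p = 0 ∧ z q = 0 ∧ cnt z = k := by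
  have hcard : k ≤ (Finset.univ \ {p, q} : Finset (Fin N)).card := by
    rw [Finset.card_sdiff_of_subset (Finset.subset_univ _), Finset.card_pair hpq]
    simp
    omega
  obtain ⟨t, ht, rfl⟩ := Finset.exists_subset_card_eq hcard
  refine ⟨fun j => if j ∈ t then 1 else 0, ?_, ?_, ?_⟩
  · have : p ∉ t := fun h => by simpa using ht h
    simp [this]
  · have : q ∉ t := fun h => by simpa using ht h
    simp [this]
  · rw [cnt_eq_card]
    congr 1
    ext j
    simp

lemma mul_pairOp_apply_vac (A : Op N) (p q : Fin N) (x : Fin N → Fin 2) :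
    (A * pairOp p q) x 0 = 0 := by
  rw [Matrix.mul_apply]
  exact Finset.sum_eq_zero fun z _ => by rw [pairOp_apply_vac, mul_zero]

lemma fsucc_of_val {p q : Fin N} (h : (p : ℕ) + 1 = q) : fsucc p = q := by
  ext
  simp [fsucc, h, Nat.mod_eq_of_lt q.2]

lemma e_castSucc {n : ℕ} (i : Fin n) : e (n + 1) i.castSucc = pairOp i.castSucc i.succ := by
  rw [e_eq_pairOp, fsucc_of_val (q := i.succ) (by simp)]

lemma e_last {n : ℕ} : e (n + 1) (Fin.last n) = pairOp (Fin.last n) 0 := by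
  rw [e_eq_pairOp]
  congr 1
  ext
  simp [fsucc]

lemma eq_zero_of_kernel_of_even {ι : Type*} (hN : Even N) {k : ℕ} (hk : Even k) (hk1 : 1 ≤ k)
    (hkN : k < N + 2) {A : Matrix (Fin (N + 2) → Fin 2) ι ℂ} {y : ι}
    (hA : ∀ j x, (e (N + 2) j * A) x y = 0) {x : Fin (N + 2) → Fin 2} (hx : cnt x = k) :
    A x y = 0 := by
  obtain ⟨k, rfl⟩ := Nat.exists_eq_add_of_le' hk1
  have hkodd : Odd k := by grind
  set last := Fin.last (N + 1) with hlast
  have hl0 : last ≠ 0 := by simp [hlast]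
  obtain ⟨z, hz1, hz0, hz⟩ := exists_cnt_eq_avoiding hl0 (k := k) (by omega)
  have hc1 := cnt_update_one hz1
  have hc0 := cnt_update_one hz0
  have hvac (x : Fin (N + 2) → Fin 2) (hx : cnt x = k + 1) :
      Fg (N + 2) (k + 1) x 0 ≠ 0 :=
    Fg_ne_zero (fun j => Fin.zero_le _) (by rw [hx]; simp [cnt])
  have hopen (x x' : Fin (N + 2) → Fin 2) (hx : cnt x = k + 1) (hx' : cnt x' = k + 1) :
      A x y * Fg (N + 2) (k + 1) x' 0 = A x' y * Fg (N + 2) (k + 1) x 0 := by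
    refine kernel_proportional (fun i x => ?_) (fun i x => ?_) hvac hx hx'
    · rw [← e_castSucc]
      exact hA _ x
    · rw [(pairOp_commute_Fg (by simp) (k + 1)).eq]
      exact mul_pairOp_apply_vac _ _ _ _
  obtain ⟨l, hl⟩ := finRange_eq_cons_concat N
  have hnd := List.nodup_finRange (N + 2)
  rw [hl] at hnd
  set Q := l ++ [last] with hQ
  have hQ0 : (0 : Fin (N + 2)) ∉ Q := (List.nodup_cons.mp hnd).1
  have hrot (x : Fin (N + 2) → Fin 2) :
      (pairOp last 0 * ordF (Q ++ [0]) (k + 1) : Op (N + 2)) x 0 = 0 := by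
    have hcomm : Commute (pairOp last 0) (ordF (Q ++ [0]) (k + 1)) := by
      rw [hQ, List.append_assoc]
      refine pairOp_commute_ordF (l₂ := []) ?_ (last_add_zero_odd hN) _
      simp [hQ, List.nodup_append] at hnd ⊢
      grind
    rw [hcomm.eq]
    exact mul_pairOp_apply_vac _ _ _ _
  have hcross := pairOp_kernel_cross hl0 (fun x => by rw [← e_last]; exact hA _ x) hrot hz1 hz0
  have hFg : Fg (N + 2) (k + 1) = f (N + 2) 0 * ordF Q k + ordF Q (k + 1) := by
    rw [Fg_eq_ordF, hl, ordF_cons_succ]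
  have hrotQ : ordF (Q ++ [0]) (k + 1) = ordF Q (k + 1) - f (N + 2) 0 * ordF Q k := by
    rw [ordF_concat_succ, f_mul_ordF, hkodd.neg_one_pow]
    simp
  have hat0 : ordF Q (k + 1) (Function.update z 0 1) 0 = 0 := by
    by_contra h
    have := (ordF_support h).1 0 hQ0
    simp at this
  have hatl : (f (N + 2) 0 * ordF Q k) (Function.update z last 1) 0 = 0 := by
    rw [f_mul_apply, Function.update_of_ne hl0.symm, hz0]
    simp
  have h0 := hopen (Function.update z last 1) (Function.update z 0 1) (by omega) (by omega)
  have hne := hvac (Function.update z 0 1) (by omega)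
  have hnel := hvac (Function.update z last 1) (by omega)
  have hAl : A (Function.update z last 1) y = 0 := by
    rw [hFg, Matrix.add_apply, hat0, add_zero] at hne
    rw [hFg, Matrix.add_apply, Matrix.add_apply, hat0, hatl] at h0
    rw [hrotQ, Matrix.sub_apply, Matrix.sub_apply, hat0, hatl] at hcross
    have : 2 * (A (Function.update z last 1) y *
        (f (N + 2) 0 * ordF Q k) (Function.update z 0 1) 0) = 0 := by
      linear_combination h0 - hcross
    simpa [hne] using this
  have hfin := hopen x (Function.update z last 1) hx (by omega)
  rw [hAl, zero_mul] at hfin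
  exact (mul_eq_zero.mp hfin).resolve_right hnel

/-- The projection onto the span of the configurations with `k` down spins. -/
def proj (N k : ℕ) : Op N := Matrix.diagonal fun x => if cnt x = k then 1 else 0

lemma proj_mul_eq_mul_proj {M N m k : ℕ} {A : Matrix (Fin M → Fin 2) (Fin N → Fin 2) ℂ}
    (hA : ∀ x y, A x y ≠ 0 → cnt x = cnt y + m) : proj M (k + m) * A = A * proj N k := by
  ext x y
  rw [proj, proj, Matrix.diagonal_mul, Matrix.mul_diagonal]
  by_cases h : A x y = 0
  · simp [h]
  · simp [hA x y h, mul_comm]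

lemma mul_proj_apply_ne_zero {M N k : ℕ} {A : Matrix (Fin M → Fin 2) (Fin N → Fin 2) ℂ}
    (hA : A * proj N k = A) {x : Fin M → Fin 2} {y : Fin N → Fin 2} (h : A x y ≠ 0) :
    cnt y = k := by
  rw [← hA, proj, Matrix.mul_diagonal] at h
  by_contra hy
  simp [hy] at h

lemma proj_mul_apply_ne_zero {M N k : ℕ} {A : Matrix (Fin M → Fin 2) (Fin N → Fin 2) ℂ}
    (hA : proj M k * A = A) {x : Fin M → Fin 2} {y : Fin N → Fin 2} (h : A x y ≠ 0) :
    cnt x = k := by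
  rw [← hA, proj, Matrix.diagonal_mul] at h
  by_contra hy
  simp [hy] at h

lemma pairOp_apply_ne_zero {p q : Fin N} {x y : Fin N → Fin 2} (h : pairOp p q x y ≠ 0) :
    cnt x = cnt y := by
  have hf {j : Fin N} {x y : Fin N → Fin 2} (h : f N j x y ≠ 0) : cnt x = cnt y + 1 := by
    rw [f_apply] at h
    by_cases hx : x j = 1 ∧ y = Function.update x j 0
    · rw [hx.2, cnt_update_zero hx.1]
    · simp [hx] at h
  have hfd {j : Fin N} {x y : Fin N → Fin 2} (h : fd N j x y ≠ 0) : cnt y = cnt x + 1 :=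
    hf (j := j) (by rwa [← f_transpose] at h)
  rw [pairOp, Matrix.mul_apply] at h
  obtain ⟨z, _, hz⟩ := Finset.exists_ne_zero_of_sum_ne_zero h
  have h1 : cnt x = cnt z + 1 := by
    by_contra hc
    have (j : Fin N) : f N j x z = 0 := not_not.mp (mt hf hc)
    simp [this] at hz
  have h2 : cnt y = cnt z + 1 := by
    by_contra hc
    have (j : Fin N) : fd N j z y = 0 := not_not.mp (mt hfd hc)
    simp [this] at hz
  omega

lemma e_commute_proj (j : Fin N) (k : ℕ) : Commute (e N j) (proj N k) :=
  (proj_mul_eq_mul_proj (m := 0) fun _ _ h => pairOp_apply_ne_zero h).symm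

lemma proj_mul_Fg (m k : ℕ) : proj N (k + m) * Fg N m = Fg N m * proj N k :=
  proj_mul_eq_mul_proj fun _ _ h => Fg_support h

end Grading

section Embedding

variable {N : ℕ}

/-- The penultimate site of a chain of length `N + 2`. -/
abbrev siteA (N : ℕ) : Fin (N + 2) := (Fin.last N).castSucc

/-- The last site of a chain of length `N + 2`. -/
abbrev siteB (N : ℕ) : Fin (N + 2) := Fin.last (N + 1)

/-- The first `N` sites of a chain of length `N + 2`. -/
abbrev bulk (j : Fin N) : Fin (N + 2) := j.castSucc.castSucc

/-- The restriction of a configuration to the first `N` sites. -/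
def res (x : Fin (N + 2) → Fin 2) : Fin N → Fin 2 := fun j => x (bulk j)

lemma siteA_ne_siteB : siteA N ≠ siteB N := by simp [Fin.ext_iff]

lemma bulk_ne_siteA (j : Fin N) : bulk j ≠ siteA N := by
  have := j.2
  simp [Fin.ext_iff]
  omega

lemma bulk_ne_siteB (j : Fin N) : bulk j ≠ siteB N := by
  have := j.2
  simp [Fin.ext_iff]
  omega

lemma odd_siteA_add_siteB : Odd ((siteA N : ℕ) + siteB N) := ⟨N, by simp; omega⟩

lemma bulk_injective : Function.Injective (bulk : Fin N → Fin (N + 2)) :=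
  (Fin.castSucc_injective _).comp (Fin.castSucc_injective _)

@[simp] lemma res_update_siteA (x : Fin (N + 2) → Fin 2) (s : Fin 2) :
    res (Function.update x (siteA N) s) = res x := by
  funext j
  exact Function.update_of_ne (bulk_ne_siteA j) _ _

@[simp] lemma res_update_siteB (x : Fin (N + 2) → Fin 2) (s : Fin 2) :
    res (Function.update x (siteB N) s) = res x := by
  funext j
  exact Function.update_of_ne (bulk_ne_siteB j) _ _

@[simp] lemma res_update_bulk (x : Fin (N + 2) → Fin 2) (j : Fin N) (s : Fin 2) :
    res (Function.update x (bulk j) s) = Function.update (res x) j s := by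
  funext i
  rcases eq_or_ne i j with rfl | h
  · simp [res]
  · rw [Function.update_of_ne h]
    exact Function.update_of_ne (bulk_injective.ne h) _ _

lemma cnt_eq_res (x : Fin (N + 2) → Fin 2) :
    cnt x = cnt (res x) + (x (siteA N) : ℕ) + (x (siteB N) : ℕ) := by
  rw [cnt, Fin.sum_univ_castSucc, Fin.sum_univ_castSucc]
  rfl

lemma phase_bulk (j : Fin N) (x : Fin (N + 2) → Fin 2) :
    phase (bulk j) x = phase j (res x) := by
  have hfilter : (Finset.univ.filter (· < bulk j) : Finset (Fin (N + 2))) =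
      (Finset.univ.filter (· < j)).map ⟨bulk, bulk_injective⟩ := by
    ext i
    simp only [Finset.mem_filter, Finset.mem_univ, true_and, Finset.mem_map,
      Function.Embedding.coeFn_mk]
    constructor
    · intro h
      have h' : (i : ℕ) < j := h
      exact ⟨⟨i, by omega⟩, h', rfl⟩
    · rintro ⟨i, h, rfl⟩
      exact h
  rw [phase, phase, hfilter, Finset.prod_map]
  rfl

/-- The map adding two up spins at the end of the chain. -/
def padUp (N : ℕ) : Matrix (Fin (N + 2) → Fin 2) (Fin N → Fin 2) ℂ :=
  Matrix.of fun x y => if x (siteA N) = 0 ∧ x (siteB N) = 0 ∧ res x = y then 1 else 0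

lemma padUp_mul_apply {ι : Type*} (A : Matrix (Fin N → Fin 2) ι ℂ) (x : Fin (N + 2) → Fin 2)
    (y : ι) : (padUp N * A) x y =
      if x (siteA N) = 0 ∧ x (siteB N) = 0 then A (res x) y else 0 := by
  by_cases ha : x (siteA N) = 0 <;> by_cases hb : x (siteB N) = 0 <;>
    simp [Matrix.mul_apply, padUp, ha, hb]

/-- The configuration extending `z` by the spins `s` and `t` at the end of the chain. -/
def extend (z : Fin N → Fin 2) (s t : Fin 2) : Fin (N + 2) → Fin 2 :=
  Fin.snoc (α := fun _ => Fin 2) (Fin.snoc (α := fun _ => Fin 2) z s) t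

@[simp] lemma extend_siteA (z : Fin N → Fin 2) (s t : Fin 2) : extend z s t (siteA N) = s := by
  simp [extend, siteA]

@[simp] lemma extend_siteB (z : Fin N → Fin 2) (s t : Fin 2) : extend z s t (siteB N) = t := by
  simp [extend, siteB]

@[simp] lemma res_extend (z : Fin N → Fin 2) (s t : Fin 2) : res (extend z s t) = z := by
  funext j
  simp [res, extend]

lemma extend_res (x : Fin (N + 2) → Fin 2) : extend (res x) (x (siteA N)) (x (siteB N)) = x := by
  funext j
  refine Fin.lastCases ?_ (fun j => Fin.lastCases ?_ (fun j => ?_) j) j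
  · simp [extend]
  · simp [extend]
  · simp [extend, res]

lemma padUp_transpose_mul_apply {ι : Type*} (A : Matrix (Fin (N + 2) → Fin 2) ι ℂ)
    (z : Fin N → Fin 2) (y : ι) : ((padUp N)ᵀ * A) z y = A (extend z 0 0) y := by
  rw [Matrix.mul_apply, Finset.sum_eq_single (extend z 0 0)]
  · simp [padUp]
  · intro x _ hx
    have : ¬(x (siteA N) = 0 ∧ x (siteB N) = 0 ∧ res x = z) := by
      rintro ⟨ha, hb, rfl⟩
      have := extend_res x
      rw [ha, hb] at this
      exact hx this.symm
    simp [padUp, this]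
  · simp

lemma padUp_transpose_mul_padUp : (padUp N)ᵀ * padUp N = 1 := by
  ext z y
  rw [padUp_transpose_mul_apply]
  simp [padUp, Matrix.one_apply]

lemma f_bulk_mul_padUp (j : Fin N) : f (N + 2) (bulk j) * padUp N = padUp N * f N j := by
  ext x y
  rw [f_mul_apply, padUp_mul_apply, f_apply]
  rw [show res x j = x (bulk j) from rfl]
  simp [padUp, Function.update_of_ne (bulk_ne_siteA j).symm,
    Function.update_of_ne (bulk_ne_siteB j).symm, phase_bulk]
  grind

lemma fd_bulk_mul_padUp (j : Fin N) : fd (N + 2) (bulk j) * padUp N = padUp N * fd N j := by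
  ext x y
  rw [fd_mul_apply, padUp_mul_apply, fd_apply]
  rw [show res x j = x (bulk j) from rfl]
  simp [padUp, Function.update_of_ne (bulk_ne_siteA j).symm,
    Function.update_of_ne (bulk_ne_siteB j).symm, phase_bulk]
  grind

lemma fd_siteA_mul_padUp : fd (N + 2) (siteA N) * padUp N = 0 := by
  ext x y
  rw [fd_mul_apply]
  simp [padUp]

lemma fd_siteB_mul_padUp : fd (N + 2) (siteB N) * padUp N = 0 := by
  ext x y
  rw [fd_mul_apply]
  simp [padUp]

/-- The embedding of the chain of length `N` that contracts the last two sites. -/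
def emb (N : ℕ) : Matrix (Fin (N + 2) → Fin 2) (Fin N → Fin 2) ℂ :=
  (f (N + 2) (siteA N) + f (N + 2) (siteB N)) * padUp N

lemma f_add_mul_emb : (f (N + 2) (siteA N) + f (N + 2) (siteB N)) * emb N = 0 := by
  rw [emb, ← Matrix.mul_assoc, f_add_mul_self, Matrix.zero_mul]

lemma fd_add_mul_emb : (fd (N + 2) (siteA N) + fd (N + 2) (siteB N)) * emb N = 0 := by
  have h : (fd (N + 2) (siteA N) + fd (N + 2) (siteB N)) *
      (f (N + 2) (siteA N) + f (N + 2) (siteB N)) =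
      -((f (N + 2) (siteA N) + f (N + 2) (siteB N)) *
        (fd (N + 2) (siteA N) + fd (N + 2) (siteB N))) := by
    simp only [add_mul, mul_add, fd_mul_f, siteA_ne_siteB, siteA_ne_siteB.symm, if_true, if_false,
      sgn_eq_neg odd_siteA_add_siteB]
    module
  rw [emb, ← Matrix.mul_assoc, h, Matrix.neg_mul, Matrix.mul_assoc, Matrix.add_mul (fd _ _),
    fd_siteA_mul_padUp, fd_siteB_mul_padUp]
  simp

lemma f_bulk_mul_emb (j : Fin N) : f (N + 2) (bulk j) * emb N = -(emb N * f N j) := by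
  rw [emb, ← Matrix.mul_assoc, mul_add, f_mul_f _ (siteA N), f_mul_f _ (siteB N), ← neg_add,
    ← add_mul, Matrix.neg_mul, Matrix.mul_assoc, f_bulk_mul_padUp, Matrix.mul_assoc]

lemma fd_bulk_mul_emb (j : Fin N) : fd (N + 2) (bulk j) * emb N = -(emb N * fd N j) := by
  rw [emb, ← Matrix.mul_assoc, mul_add, fd_mul_f_of_ne (bulk_ne_siteA j),
    fd_mul_f_of_ne (bulk_ne_siteB j), ← neg_add,
    ← add_mul, Matrix.neg_mul, Matrix.mul_assoc, fd_bulk_mul_padUp, Matrix.mul_assoc]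

lemma pairOp_bulk_mul_emb (p q : Fin N) :
    pairOp (bulk p) (bulk q) * emb N = emb N * pairOp p q := by
  rw [pairOp, pairOp, Matrix.mul_assoc, Matrix.add_mul (fd _ _), fd_bulk_mul_emb, fd_bulk_mul_emb,
    ← neg_add, ← Matrix.mul_add, Matrix.mul_neg, ← Matrix.mul_assoc, Matrix.add_mul,
    f_bulk_mul_emb, f_bulk_mul_emb, ← neg_add, ← Matrix.mul_add, Matrix.neg_mul, neg_neg,
    Matrix.mul_assoc]

lemma emb_mul_cancel {ι : Type*} {A B : Matrix (Fin N → Fin 2) ι ℂ} (h : emb N * A = emb N * B) :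
    A = B := by
  ext z y
  let w := extend z 1 0
  have hwa : w (siteA N) = 1 := extend_siteA _ _ _
  have hwb : w (siteB N) = 0 := extend_siteB _ _ _
  have hw : res w = z := res_extend _ _ _
  have key (A : Matrix (Fin N → Fin 2) ι ℂ) :
      (emb N * A) w y = phase (siteA N) w * A z y := by
    rw [emb, Matrix.mul_assoc, Matrix.add_mul, Matrix.add_apply, f_mul_apply, f_mul_apply,
      if_pos hwa, hwb, padUp_mul_apply]
    simp [hwb, hw, Function.update_of_ne siteA_ne_siteB.symm]
  have := congrFun (congrFun h w) y
  rw [key, key] at this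
  exact mul_left_cancel₀ (phase_ne_zero _ _) this

lemma pairOp_eq_emb_mul : pairOp (siteA N) (siteB N) =
    emb N * ((padUp N)ᵀ * (fd (N + 2) (siteA N) + fd (N + 2) (siteB N))) := by
  have hproj {y : Fin (N + 2) → Fin 2} (x) (A : Op (N + 2)) : (padUp N * ((padUp N)ᵀ * A)) x y =
      if x (siteA N) = 0 ∧ x (siteB N) = 0 then A x y else 0 := by
    rw [padUp_mul_apply]
    split_ifs with h
    · rw [padUp_transpose_mul_apply]
      nth_rw 2 [← extend_res x]
      rw [h.1, h.2]
    · rfl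
  ext x y
  rw [pairOp, emb, Matrix.mul_assoc, Matrix.add_mul, Matrix.add_mul, Matrix.add_apply,
    Matrix.add_apply]
  simp only [f_mul_apply, hproj]
  have hne := siteA_ne_siteB (N := N)
  by_cases ha : x (siteA N) = 1 <;> by_cases hb : x (siteB N) = 1
  · simp [ha, hb, hne, hne.symm, fd_apply, phase_update_of_le]
    rw [Function.update_eq_self_iff.mpr ha.symm, Function.update_eq_self_iff.mpr hb.symm,
      phase_mul_self, phase_mul_self]
    split_ifs
    · simp [pow_succ]
    · simp
  · have hb0 : x (siteB N) = 0 := by omega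
    simp [hb0, hne.symm]
  · have ha0 : x (siteA N) = 0 := by omega
    simp [ha0, hne]
  · simp [ha, hb]

lemma pairOp_mul_eq_emb : pairOp (siteA N) (siteB N) *
    (sgn (siteA N) • (f (N + 2) (siteA N) * padUp N)) = emb N := by
  rw [Matrix.mul_smul, ← Matrix.mul_assoc, pairOp_mul_f_left siteA_ne_siteB, Matrix.add_mul,
    pairOp, Matrix.mul_assoc (f _ _), Matrix.mul_assoc (f _ _ + _), Matrix.add_mul (fd _ _),
    fd_siteA_mul_padUp, fd_siteB_mul_padUp, Matrix.smul_mul, smul_add, smul_smul, sgn_mul_self]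
  simp [emb]

lemma ordF_bulk_mul_emb (l : List (Fin N)) (m : ℕ) :
    ordF (l.map bulk) m * emb N = (-1 : ℂ) ^ m • (emb N * ordF l m) := by
  induction m generalizing l with
  | zero => simp
  | succ m ihm =>
    induction l with
    | nil => simp [ordF]
    | cons a l ih =>
      rw [List.map_cons, ordF_cons_succ, ordF_cons_succ, Matrix.add_mul, Matrix.mul_assoc, ihm, ih,
        Matrix.mul_smul, ← Matrix.mul_assoc, f_bulk_mul_emb, Matrix.mul_add, Matrix.neg_mul,
        Matrix.mul_assoc, smul_add, pow_succ]
      simp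

lemma finRange_add_two : List.finRange (N + 2) =
    (List.finRange N).map bulk ++ [siteA N] ++ [siteB N] := by
  rw [List.finRange_succ_last, List.finRange_succ_last]
  simp [Function.comp_def]

lemma Fg_mul_emb (m : ℕ) :
    Fg (N + 2) m * emb N = (-1 : ℂ) ^ m • (emb N * Fg N m) := by
  rw [Fg_eq_ordF, Fg_eq_ordF, ← ordF_bulk_mul_emb, finRange_add_two]
  generalize (List.finRange N).map bulk = l
  have hab : f (N + 2) (siteB N) * emb N = -(f (N + 2) (siteA N) * emb N) := by
    have := f_add_mul_emb (N := N)
    rw [Matrix.add_mul] at this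
    exact eq_neg_of_add_eq_zero_right this
  have haab : f (N + 2) (siteA N) * (f (N + 2) (siteB N) * emb N) = 0 := by
    rw [hab, Matrix.mul_neg, ← Matrix.mul_assoc, f_mul_f_self]
    simp
  rcases m with _ | _ | m
  · simp
  · rw [ordF_concat_succ, ordF_concat_succ]
    simp only [ordF_zero, Matrix.add_mul, one_mul, hab]
    simp
  · rw [ordF_concat_succ, ordF_concat_succ, ordF_concat_succ]
    simp only [Matrix.add_mul, Matrix.mul_assoc, haab]
    simp [hab]

lemma emb_support {x : Fin (N + 2) → Fin 2} {y : Fin N → Fin 2} (h : emb N x y ≠ 0) :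
    cnt x = cnt y + 1 := by
  rw [emb, Matrix.add_mul, Matrix.add_apply, f_mul_apply, f_mul_apply] at h
  rw [cnt_eq_res]
  by_cases ha : x (siteA N) = 1 <;> by_cases hb : x (siteB N) = 1
  · simp [padUp, ha, hb, siteA_ne_siteB.symm] at h
  · have hb0 : x (siteB N) = 0 := by omega
    simp [padUp, ha, hb0, siteA_ne_siteB.symm] at h
    simp [ha, hb0, h]
  · have ha0 : x (siteA N) = 0 := by omega
    simp [padUp, ha0, hb] at h
    simp [ha0, hb, h]
  · simp [ha, hb] at h

end Embedding

section Rigidity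

variable {N : ℕ}

lemma odd_add_fsucc (hN : Even N) (j : Fin (N + 2)) : Odd ((j : ℕ) + fsucc j) := by
  rcases fsucc_cases j with h | ⟨rfl, h⟩
  · exact ⟨j, by omega⟩
  · rw [h]
    exact last_add_zero_odd hN

lemma exists_mul_emb_eq (hN : Even N) (j : Fin N) : ∃ W : Op (N + 2),
    (∀ M : Op (N + 2), (∀ i, Commute (e (N + 2) i) M) → Commute W M) ∧
      W * emb N = emb N * e N j := by
  obtain ⟨n, rfl⟩ : ∃ n, N = n + 2 := by
    obtain ⟨r, rfl⟩ := hN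
    exact ⟨r + r - 2, by have := j.2; omega⟩
  rcases fsucc_cases j with h | ⟨rfl, h⟩
  · refine ⟨e _ (bulk j), fun M hM => hM _, ?_⟩
    rw [e_eq_pairOp, fsucc_of_val (q := bulk (fsucc j)) (by simpa using h), pairOp_bulk_mul_emb,
      e_eq_pairOp]
  · refine ⟨e _ (siteA _) * e _ (bulk (Fin.last (n + 1))) * e _ (siteB _),
      fun M hM => ((hM _).mul_left (hM _)).mul_left (hM _), ?_⟩
    have hX : emb (n + 2) = emb (n + 2) * (padUp (n + 2))ᵀ * padUp (n + 2) := by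
      rw [Matrix.mul_assoc, padUp_transpose_mul_padUp, Matrix.mul_one]
    have hb : bulk (0 : Fin (n + 2)) = 0 := rfl
    have key := pairOp_mul_joined (p := bulk (Fin.last (n + 1))) (q := bulk 0)
      (bulk_ne_siteA _) (bulk_ne_siteB _) (bulk_injective.ne (by simp)) siteA_ne_siteB
      (bulk_ne_siteA _).symm (bulk_ne_siteB _).symm odd_siteA_add_siteB
      (X := emb (n + 2) * (padUp (n + 2))ᵀ)
      (by rw [← Matrix.mul_assoc, f_add_mul_emb, Matrix.zero_mul])
      (by rw [← Matrix.mul_assoc, fd_add_mul_emb, Matrix.zero_mul])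
    rw [e_eq_pairOp, e_eq_pairOp, e_last,
      fsucc_of_val (p := siteA (n + 2)) (q := siteB _) (by simp),
      fsucc_of_val (p := bulk (Fin.last (n + 1))) (q := siteA _) (by simp), e_eq_pairOp, h,
      ← pairOp_bulk_mul_emb, hX, ← Matrix.mul_assoc, ← Matrix.mul_assoc (pairOp _ (bulk 0)), ← key]
    rfl

lemma mul_e_fsucc_eq_zero (hN : Even N) {T : Op (N + 2)} (hT : ∀ j, Commute (e (N + 2) j) T)
    {j : Fin (N + 2)} (h : T * e (N + 2) j = 0) : T * e (N + 2) (fsucc j) = 0 := by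
  have hne (i : Fin (N + 2)) : i ≠ fsucc i := by
    have := odd_add_fsucc hN i
    intro hi
    rw [← hi] at this
    grind
  rcases eq_or_ne (fsucc (fsucc j)) j with hj | hj
  · rw [e_eq_pairOp, hj, pairOp_comm]
    exact h
  · have hodd := odd_add_fsucc hN (fsucc j)
    rw [add_comm] at hodd
    have key := pairOp_mul_pairOp_mul_pairOp (hne (fsucc j)).symm (hne j).symm hj hodd
    rw [pairOp_comm _ (fsucc j), pairOp_comm _ j, ← e_eq_pairOp, ← e_eq_pairOp] at key
    rw [← key, ← mul_assoc, ← mul_assoc, ← (hT _).eq, mul_assoc _ T, h, mul_zero, zero_mul]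

lemma mul_e_eq_zero (hN : Even N) {T : Op (N + 2)} (hT : ∀ j, Commute (e (N + 2) j) T)
    {i : Fin (N + 2)} (h : T * e (N + 2) i = 0) (j : Fin (N + 2)) : T * e (N + 2) j = 0 := by
  have hiter (n : ℕ) : T * e (N + 2) (fsucc^[n] i) = 0 ∧
      (fsucc^[n] i : ℕ) = (i + n) % (N + 2) := by
    induction n with
    | zero => exact ⟨h, by simp [Nat.mod_eq_of_lt i.2]⟩
    | succ n ih =>
      rw [Function.iterate_succ_apply']
      refine ⟨mul_e_fsucc_eq_zero hN hT ih.1, ?_⟩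
      simp [fsucc, ih.2, add_assoc]
  have hj : fsucc^[N + 2 - i + j] i = j := by
    ext
    rw [(hiter _).2, show (i : ℕ) + (N + 2 - i + j) = j + (N + 2) by have := i.2; omega,
      Nat.add_mod_right, Nat.mod_eq_of_lt j.2]
  rw [← hj]
  exact (hiter _).1

lemma exists_scalar_of_vac {m : ℕ} {M : Op (N + 2)} (h₁ : M * proj (N + 2) 0 = M)
    (h₂ : proj (N + 2) m * M = M) (hM : ∀ j, Commute (e (N + 2) j) M) :
    ∃ c : ℂ, M = c • (Fg (N + 2) m * proj (N + 2) 0) := by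
  obtain ⟨c, hc⟩ := exists_scalar_of_kernel (A := M) (B := Fg (N + 2) m) (y := 0) (y' := 0) (k := m)
    (fun i x => by rw [← e_castSucc, (hM _).eq, e_castSucc, mul_pairOp_apply_vac])
    (fun i x => by
      rw [(pairOp_commute_Fg (by simp) m).eq]
      exact mul_pairOp_apply_vac _ _ _ _)
    (fun x => proj_mul_apply_ne_zero h₂)
    (fun x => ⟨fun h => by simpa [cnt] using Fg_support h,
      fun h => Fg_ne_zero (fun j => Fin.zero_le _) (by rw [h]; simp [cnt])⟩)
  refine ⟨c, ?_⟩
  ext x y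
  rw [Matrix.smul_apply, proj, Matrix.mul_diagonal, smul_eq_mul]
  by_cases hy : cnt y = 0
  · rw [if_pos hy, mul_one, eq_zero_of_cnt_eq_zero hy, hc]
  · rw [if_neg hy, mul_zero, mul_zero]
    exact not_not.mp (mt (mul_proj_apply_ne_zero h₁) hy)

lemma pairOp_mul_apply_full {p q : Fin N} (hpq : p ≠ q) (hodd : Odd ((p : ℕ) + q)) (A : Op N)
    (x : Fin N → Fin 2) : (pairOp p q * A) 1 x = 0 := by
  rw [Matrix.mul_apply]
  refine Finset.sum_eq_zero fun z _ => ?_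
  rw [← pairOp_transpose, Matrix.transpose_apply, pairOp_apply_full hpq hodd, zero_mul]

lemma exists_scalar_of_full {k m : ℕ} (hkm : k + m = N + 2) {M : Op (N + 2)}
    (h₁ : M * proj (N + 2) k = M) (h₂ : proj (N + 2) (k + m) * M = M)
    (hM : ∀ j, Commute (e (N + 2) j) M) :
    ∃ c : ℂ, M = c • (Fg (N + 2) m * proj (N + 2) k) := by
  have hfull {A : Op (N + 2)} (i : Fin (N + 1)) (x : Fin (N + 2) → Fin 2)
      (hA : Commute (pairOp i.castSucc i.succ) A) :
      (pairOp i.castSucc i.succ * Aᵀ) x 1 = 0 := by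
    rw [← pairOp_transpose, ← Matrix.transpose_mul, Matrix.transpose_apply, ← hA.eq]
    exact pairOp_mul_apply_full (Fin.castSucc_lt_succ).ne ⟨i, by simp; omega⟩ _ _
  have hone : cnt (1 : Fin (N + 2) → Fin 2) = k + m := by simp [cnt, hkm]
  obtain ⟨c, hc⟩ := exists_scalar_of_kernel (A := Mᵀ) (B := (Fg (N + 2) m)ᵀ) (y := 1) (y' := 1)
    (k := k) (fun i x => hfull i x (by rw [← e_castSucc]; exact hM _))
    (fun i x => hfull i x (pairOp_commute_Fg (by simp) m))
    (fun x => mul_proj_apply_ne_zero h₁)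
    (fun x => by
      rw [Matrix.transpose_apply]
      exact ⟨fun h => by have := Fg_support h; omega,
        fun h => Fg_ne_zero (fun j => Fin.le_last (x j)) (by rw [h, hone])⟩)
  refine ⟨c, ?_⟩
  rw [← proj_mul_Fg]
  ext x y
  rw [Matrix.smul_apply, proj, Matrix.diagonal_mul, smul_eq_mul]
  by_cases hx : cnt x = k + m
  · rw [if_pos hx, one_mul, eq_one_of_cnt_eq (hx.trans hkm)]
    exact hc y
  · rw [if_neg hx, zero_mul, mul_zero]
    exact not_not.mp (mt (proj_mul_apply_ne_zero h₂) hx)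

lemma proj_mul_emb (k : ℕ) : proj (N + 2) (k + 1) * emb N = emb N * proj N k :=
  proj_mul_eq_mul_proj fun _ _ => emb_support

lemma proj_mul_self (k : ℕ) : proj N k * proj N k = proj N k := by
  simp [proj, Matrix.diagonal_mul_diagonal]

lemma exists_mul_emb_eq_emb_mul (hN : Even N) {k m : ℕ} {M : Op (N + 2)}
    (h₁ : M * proj (N + 2) (k + 1) = M) (h₂ : proj (N + 2) (k + 1 + m) * M = M)
    (hM : ∀ j, Commute (e (N + 2) j) M) :
    ∃ M' : Op N, M * emb N = emb N * M' ∧ M' * proj N k = M' ∧ proj N (k + m) * M' = M' ∧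
      ∀ j, Commute (e N j) M' := by
  obtain ⟨M', hM'⟩ : ∃ M' : Op N, M * emb N = emb N * M' := by
    refine ⟨(padUp N)ᵀ * (fd (N + 2) (siteA N) + fd (N + 2) (siteB N)) *
      (M * (sgn (siteA N) • (f (N + 2) (siteA N) * padUp N))), ?_⟩
    have hcomm := hM (siteA N)
    rw [e_eq_pairOp, fsucc_of_val (q := siteB N) (by simp)] at hcomm
    rw [← Matrix.mul_assoc (emb N), ← pairOp_eq_emb_mul, ← Matrix.mul_assoc, hcomm.eq,
      Matrix.mul_assoc, pairOp_mul_eq_emb]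
  refine ⟨M', hM', emb_mul_cancel ?_, emb_mul_cancel ?_, fun j => emb_mul_cancel ?_⟩
  · rw [← Matrix.mul_assoc, ← hM', Matrix.mul_assoc, ← proj_mul_emb, ← Matrix.mul_assoc, h₁]
  · rw [← Matrix.mul_assoc, ← proj_mul_emb, Matrix.mul_assoc, ← hM', ← Matrix.mul_assoc,
      show k + m + 1 = k + 1 + m by omega, h₂]
  · obtain ⟨W, hW, hWe⟩ := exists_mul_emb_eq hN j
    change emb N * (e N j * M') = emb N * (M' * e N j)
    rw [← Matrix.mul_assoc, ← hWe, Matrix.mul_assoc, ← hM', ← Matrix.mul_assoc, (hW M hM).eq,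
      Matrix.mul_assoc, hWe, ← Matrix.mul_assoc, hM', Matrix.mul_assoc]

lemma eq_zero_of_mul_emb_eq_zero (hN : Even N) {k m : ℕ} (hm : Odd m) (hk : 1 ≤ k)
    (hkm : k + m < N + 2) {T : Op (N + 2)} (h₁ : T * proj (N + 2) k = T)
    (h₂ : proj (N + 2) (k + m) * T = T) (hT : ∀ j, Commute (e (N + 2) j) T)
    (hemb : T * emb N = 0) : T = 0 := by
  have hA : T * e (N + 2) (siteA N) = 0 := by
    rw [e_eq_pairOp, fsucc_of_val (q := siteB N) (by simp), pairOp_eq_emb_mul, ← Matrix.mul_assoc,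
      hemb, Matrix.zero_mul]
  have hzero := mul_e_eq_zero hN hT hA
  ext x y
  by_contra hne
  rcases Nat.even_or_odd k with hke | hko
  · refine hne (eq_zero_of_kernel_of_even hN hke hk (by omega) (A := Tᵀ) (fun j z => ?_)
      (mul_proj_apply_ne_zero h₁ hne))
    rw [e_eq_pairOp, ← pairOp_transpose, ← Matrix.transpose_mul, ← e_eq_pairOp, hzero]
    rfl
  · refine hne (eq_zero_of_kernel_of_even hN (hko.add_odd hm) (by omega) hkm (A := T)
      (fun j z => ?_) (proj_mul_apply_ne_zero h₂ hne))
    rw [(hT j).eq, hzero]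
    rfl

lemma eq_zero_of_proj_mul {k : ℕ} {M : Op N} (hk : N < k) (h : proj N k * M = M) : M = 0 := by
  ext x y
  by_contra hne
  have := proj_mul_apply_ne_zero h hne
  have := cnt_le x
  omega

/-- An operator of odd degree `m` on the sector with `k` down spins that commutes with the periodic
Temperley–Lieb generators is a multiple of `F_(m)`. -/
theorem exists_eq_smul_Fg (L : ℕ) {k m : ℕ} (hm : Odd m) {M : Op (2 * L)}
    (h₁ : M * proj (2 * L) k = M) (h₂ : proj (2 * L) (k + m) * M = M)
    (hM : ∀ j, Commute (e (2 * L) j) M) :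
    ∃ c : ℂ, M = c • (Fg (2 * L) m * proj (2 * L) k) := by
  induction L generalizing k with
  | zero =>
    refine ⟨0, ?_⟩
    rw [zero_smul]
    exact eq_zero_of_proj_mul (by have := hm.pos; omega) h₂
  | succ L ih =>
    have hN : Even (2 * L) := even_two_mul L
    change Op (2 * L + 2) at M
    change M * proj (2 * L + 2) k = M at h₁
    change proj (2 * L + 2) (k + m) * M = M at h₂
    change ∀ j, Commute (e (2 * L + 2) j) M at hM
    change ∃ c : ℂ, M = c • (Fg (2 * L + 2) m * proj (2 * L + 2) k)
    rcases lt_trichotomy (k + m) (2 * L + 2) with hlt | heq | hgt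
    · rcases k with _ | k
      · rw [zero_add] at h₂
        exact exists_scalar_of_vac h₁ h₂ hM
      · obtain ⟨M', hM', h₁', h₂', hcomm⟩ := exists_mul_emb_eq_emb_mul hN h₁ h₂ hM
        obtain ⟨c, rfl⟩ := ih h₁' h₂' hcomm
        refine ⟨-c, ?_⟩
        set G := Fg (2 * L + 2) m * proj (2 * L + 2) (k + 1) with hG
        have hG₁ : G * proj (2 * L + 2) (k + 1) = G := by
          rw [hG, mul_assoc, proj_mul_self]
        have hG₂ : proj (2 * L + 2) (k + 1 + m) * G = G := by
          rw [hG, ← mul_assoc, proj_mul_Fg, mul_assoc, proj_mul_self]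
        have hGe (j) : Commute (e (2 * L + 2) j) G :=
          (e_commute_Fg (hN.add even_two) j hm).mul_right (e_commute_proj j _)
        have hGemb : G * emb (2 * L) = -(emb (2 * L) * (Fg (2 * L) m * proj (2 * L) k)) := by
          rw [hG, Matrix.mul_assoc, proj_mul_emb, ← Matrix.mul_assoc, Fg_mul_emb, hm.neg_one_pow,
            neg_one_smul, Matrix.neg_mul, Matrix.mul_assoc]
        have key := eq_zero_of_mul_emb_eq_zero hN hm (Nat.succ_pos k) hlt (T := M + c • G)
          (by rw [add_mul, h₁, smul_mul_assoc, hG₁]) (by rw [mul_add, h₂, mul_smul_comm, hG₂])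
          (fun j => (hM j).add_right ((hGe j).smul_right c))
          (by rw [Matrix.add_mul, Matrix.smul_mul, hM', hGemb, Matrix.mul_smul]; simp)
        rw [neg_smul]
        exact eq_neg_of_add_eq_zero_left key
    · exact exists_scalar_of_full heq h₁ h₂ hM
    · exact ⟨0, by rw [zero_smul]; exact eq_zero_of_proj_mul hgt h₂⟩

end Rigidity

section Sectors

variable {L : ℕ}

lemma Sz_eq_diagonal (N : ℕ) : Sz N = Matrix.diagonal fun x => (N : ℂ) / 2 - cnt x := by
  have hsite (j : Fin N) : site N sigmaZ j = Matrix.diagonal fun x => 1 - 2 * ((x j : ℕ) : ℂ) := by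
    ext x y
    rw [site_apply, Matrix.diagonal_apply]
    by_cases h : x = y
    · subst h
      rw [Function.update_eq_self, if_pos rfl, if_pos rfl]
      generalize x j = s
      fin_cases s <;> norm_num [sigmaZ]
    · rw [if_neg h]
      split_ifs with hy
      · have hne : x j ≠ y j := fun hj => h (by rw [hy, ← hj, Function.update_eq_self])
        generalize x j = s, y j = t at hne
        fin_cases s <;> fin_cases t <;> simp [sigmaZ] at hne ⊢
      · rfl
  rw [Sz]
  ext x y
  simp only [hsite, Matrix.smul_apply, Matrix.sum_apply, Matrix.diagonal_apply]
  split_ifs with h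
  · rw [Finset.sum_sub_distrib, ← Finset.mul_sum, cnt]
    push_cast
    simp
    ring
  · simp

lemma mem_sector_iff {k : ℤ} {v : V (2 * L)} :
    v ∈ sector L k ↔ ∀ x, v x ≠ 0 → (cnt x : ℤ) = k := by
  rw [sector, Module.End.mem_eigenspace_iff, Matrix.mulVecLin_apply, Sz_eq_diagonal, funext_iff]
  refine forall_congr' fun x => ?_
  rw [Matrix.mulVec_diagonal, Pi.smul_apply, smul_eq_mul, mul_eq_mul_right_iff,
    or_iff_not_imp_right]
  refine imp_congr_right fun _ => ?_
  push_cast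
  rw [mul_div_cancel_left₀ _ two_ne_zero, sub_right_inj]
  exact_mod_cast Iff.rfl

lemma mem_sector_iff_proj {k : ℕ} {v : V (2 * L)} :
    v ∈ sector L k ↔ proj (2 * L) k *ᵥ v = v := by
  rw [mem_sector_iff, funext_iff]
  refine forall_congr' fun x => ?_
  rw [proj, Matrix.mulVec_diagonal]
  by_cases h : cnt x = k
  · simp [h]
  · simp [h, eq_comm (a := v x)]

lemma exists_matrix_of_mem_EperOddSet {k t : ℤ} {a b : ℕ} (ha : k = a) (hb : k - 2 * t - 1 = b)
    {T : sector L k →ₗ[ℂ] sector L (k - 2 * t - 1)} (hT : T ∈ EperOddSet L k t) :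
    ∃ M : Op (2 * L), M * proj (2 * L) a = M ∧ proj (2 * L) b * M = M ∧
      (∀ j, Commute (e (2 * L) j) M) ∧ ∀ v : sector L k, (T v : V (2 * L)) = M *ᵥ v := by
  have hproj (v : V (2 * L)) : proj (2 * L) a *ᵥ v ∈ sector L k := by
    rw [ha, mem_sector_iff_proj, Matrix.mulVec_mulVec, proj_mul_self]
  let P : V (2 * L) →ₗ[ℂ] sector L k :=
    (Matrix.mulVecLin (proj (2 * L) a)).codRestrict (sector L k) hproj
  have hP (v : V (2 * L)) : (P v : V (2 * L)) = proj (2 * L) a *ᵥ v := rfl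
  let M : Op (2 * L) := LinearMap.toMatrix' ((sector L (k - 2 * t - 1)).subtype ∘ₗ T ∘ₗ P)
  have hM (v : V (2 * L)) : M *ᵥ v = T (P v) := by
    rw [← Matrix.toLin'_apply, Matrix.toLin'_toMatrix']
    rfl
  have hext {A B : Op (2 * L)} (h : ∀ v, A *ᵥ v = B *ᵥ v) : A = B :=
    Matrix.toLin'.injective (LinearMap.ext h)
  refine ⟨M, hext fun v => ?_, hext fun v => ?_, fun j => hext fun v => ?_, fun v => ?_⟩
  · rw [← Matrix.mulVec_mulVec, hM, hM]
    congr 2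
    ext1
    rw [hP, hP, Matrix.mulVec_mulVec, proj_mul_self]
  · rw [← Matrix.mulVec_mulVec, hM, ← mem_sector_iff_proj, ← hb]
    exact (T (P v)).2
  · rw [← Matrix.mulVec_mulVec, ← Matrix.mulVec_mulVec, hM, hM]
    refine (hT j (P v) (P (e (2 * L) j *ᵥ v)) ?_).symm
    rw [hP, hP, Matrix.mulVec_mulVec, Matrix.mulVec_mulVec, (e_commute_proj j a).eq]
  · rw [hM]
    congr 2
    ext1
    have hv := v.2
    simp only [ha] at hv
    rw [hP, mem_sector_iff_proj.mp hv]

end Sectors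

/-- **Lemma B.2: all periodic Temperley–Lieb intertwiners between sectors whose
`S^z`-values differ by an odd integer come from `U_q^odd sl(2)`:** every
`T : H_(k) → H_(k−2t−1)` commuting with all periodic `e_j` is a scalar multiple
of the restriction of `F†_(2t+1)` if `t ≥ 0`, and of `F_(−2t−1)` if `t ≤ −1`. -/
theorem gl11_periodic_TL_odd_intertwiners (L : ℕ) (hL : 0 < L) (k t : ℤ)
    (hk0 : 0 ≤ k) (hkN : k ≤ 2 * L)
    (hk0' : 0 ≤ k - 2 * t - 1) (hkN' : k - 2 * t - 1 ≤ 2 * L) :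
    ∀ T ∈ EperOddSet L k t,
      (0 ≤ t → ∃ cc : ℂ, ∀ v : ↥(sector L k),
        ((T v : V (2 * L))) = cc • (Fdg (2 * L) ((2 * t + 1).toNat)).mulVec (v : V (2 * L))) ∧
      (t ≤ -1 → ∃ cc : ℂ, ∀ v : ↥(sector L k),
        ((T v : V (2 * L))) = cc • (Fg (2 * L) ((-2 * t - 1).toNat)).mulVec (v : V (2 * L))) := by
  intro T hT
  obtain ⟨a, ha⟩ := Int.eq_ofNat_of_zero_le hk0
  obtain ⟨b, hb⟩ := Int.eq_ofNat_of_zero_le hk0'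
  obtain ⟨M, h₁, h₂, hM, hTM⟩ := exists_matrix_of_mem_EperOddSet ha hb hT
  have hv (v : sector L k) : proj (2 * L) a *ᵥ (v : V (2 * L)) = v :=
    mem_sector_iff_proj.mp (ha ▸ v.2)
  refine ⟨fun ht => ?_, fun ht => ?_⟩
  · obtain ⟨n, rfl⟩ := Int.eq_ofNat_of_zero_le ht
    have hm : (2 * (n : ℤ) + 1).toNat = 2 * n + 1 := by omega
    obtain rfl : a = b + (2 * n + 1) := by omega
    have hprojT (k : ℕ) : (proj (2 * L) k)ᵀ = proj (2 * L) k := Matrix.diagonal_transpose _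
    obtain ⟨c, hc⟩ := exists_eq_smul_Fg L (odd_two_mul_add_one n) (M := Mᵀ)
      (by rw [← hprojT, ← Matrix.transpose_mul, h₂])
      (by rw [← hprojT, ← Matrix.transpose_mul, h₁])
      (fun j => by
        have := congrArg Matrix.transpose (hM j).eq
        rw [Matrix.transpose_mul, Matrix.transpose_mul, e_eq_pairOp, pairOp_transpose] at this
        exact this.symm)
    obtain ⟨s, hs, hF⟩ := Fdg_eq_transpose (2 * L) (2 * n + 1)
    refine ⟨c * s⁻¹, fun v => ?_⟩
    rw [← proj_mul_Fg] at hc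
    rw [hTM, hm, hF, ← Matrix.transpose_transpose M, hc, Matrix.transpose_smul,
      Matrix.transpose_mul, hprojT, Matrix.smul_mulVec, ← Matrix.mulVec_mulVec, hv,
      Matrix.smul_mulVec, smul_smul, inv_mul_cancel_right₀ hs]
  · obtain ⟨n, hn⟩ := Int.eq_ofNat_of_zero_le (show 0 ≤ -t - 1 by omega)
    have hm : (-2 * t - 1).toNat = 2 * n + 1 := by omega
    obtain rfl : b = a + (2 * n + 1) := by omega
    obtain ⟨c, rfl⟩ := exists_eq_smul_Fg L (odd_two_mul_add_one n) h₁ h₂ hM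
    exact ⟨c, fun v => by
      rw [hTM, hm, Matrix.smul_mulVec, ← Matrix.mulVec_mulVec, hv]⟩

end SpinChain

end
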